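/- Let d ≥ 5 and α ∈ (0, d-4) with α ≠ d - 2n for every n ∈ ℕ, let K(x) = |x|^{-α}, and set k = ⌊(d-α)/2⌋ (so k ≥ 2). There exists a constant C > 0 depending only on α and d such that for every μ ∈ C_c^∞(ℝ^d;ℝ) and every u ∈ C_c^∞(ℝ^d;ℝ^d), T(μ,u) ≤ C ( ‖∇u‖_{L^∞} + ‖∇^k u‖_{L^{d/(k-1)}} + ‖∇^{k+1} u‖_{L^{d/k}} ) E(μ), i.e. ∬ μ(x) μ(y) u(x)·∇K(x-y) dx dy ≤ C ( ‖∇u‖_{L^∞} + ‖∇^k u‖_{L^{d/(k-1)}} + ‖∇^{k+1} u‖_{L^{d/k}} ) ∬ μ(x) μ(y) |x-y|^{-α} dx dy. -/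

import Mathlib

open MeasureTheory

noncomputable section

/-- The `L^p(ℝ^d)` norm of the `k`-th iterated derivative of `u : ℝ^d → ℝ^d`. -/
noncomputable def sobSeminorm (d : ℕ) (k : ℕ) (p : ℝ)
    (u : EuclideanSpace ℝ (Fin d) → EuclideanSpace ℝ (Fin d)) : ℝ :=
  (∫ x, ‖iteratedFDeriv ℝ k u x‖ ^ p) ^ p⁻¹

open Filter Topology SchwartzMap
open scoped NNReal ENNReal ContDiff LineDeriv FourierTransform

section Sobolev

variable {V F : Type*} [NormedAddCommGroup V] [InnerProductSpace ℝ V] [FiniteDimensional ℝ V]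
  [MeasurableSpace V] [BorelSpace V] [NormedAddCommGroup F] [NormedSpace ℝ F]

/-- The Gagliardo-Nirenberg-Sobolev inequality for Schwartz functions. -/
theorem SchwartzMap.eLpNorm_le_eLpNorm_fderiv [FiniteDimensional ℝ F] {p p' : ℝ≥0} (hp : 1 ≤ p)
    (hn : 0 < Module.finrank ℝ V)
    (hp' : (p' : ℝ)⁻¹ = (p : ℝ)⁻¹ - (Module.finrank ℝ V : ℝ)⁻¹) (f : 𝓢(V, F)) :
    eLpNorm f p' volume ≤
      SNormLESNormFDerivOfEqConst F (volume : Measure V) p * eLpNorm (fderiv ℝ f) p volume := by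
  set C : ℝ≥0 := SNormLESNormFDerivOfEqConst F (volume : Measure V) p
  let χ : ContDiffBump (0 : V) := ⟨1, 2, one_pos, one_lt_two⟩
  obtain ⟨K, hK⟩ : ∃ K, ∀ x, ‖fderiv ℝ χ x‖ ≤ K :=
    (χ.hasCompactSupport.fderiv ℝ).exists_bound_of_continuous
      ((χ.contDiff (n := 1)).continuous_fderiv one_ne_zero)
  let a : ℕ → ℝ := fun n ↦ ((n : ℝ) + 1)⁻¹
  have ha : ∀ n, 0 < a n := fun n ↦ by positivity
  have ha0 : Tendsto a atTop (𝓝 0) := by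
    simpa [a, one_div] using tendsto_one_div_add_atTop_nhds_zero_nat (𝕜 := ℝ)
  let g : ℕ → V → F := fun n x ↦ χ (a n • x) • f x
  have hχd : ∀ n, ContDiff ℝ 1 (fun x : V ↦ χ (a n • x)) := fun n ↦
    χ.contDiff.comp (contDiff_const_smul _)
  have hg : ∀ n, ContDiff ℝ 1 (g n) := fun n ↦ (hχd n).smul (f.smooth 1)
  have hgs : ∀ n, HasCompactSupport (g n) := fun n ↦
    HasCompactSupport.smul_right (χ.hasCompactSupport.comp_smul (ha n).ne')
  have hlim : ∀ x, Tendsto (fun n ↦ g n x) atTop (𝓝 (f x)) := by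
    intro x
    have : Tendsto (fun n ↦ χ (a n • x)) atTop (𝓝 (χ ((0 : ℝ) • x))) :=
      (χ.continuous.tendsto _).comp (ha0.smul_const x)
    have h1 : χ ((0 : ℝ) • x) = 1 := by
      rw [zero_smul]
      exact χ.one_of_mem_closedBall (by simp [χ])
    rw [h1] at this
    simpa using this.smul_const (f x)
  have hfd : ∀ n x, ‖fderiv ℝ (g n) x‖ ≤ ‖fderiv ℝ f x‖ + a n * K * ‖f x‖ := by
    intro n x
    have h1 : fderiv ℝ (g n) x = χ (a n • x) • fderiv ℝ f x
        + (fderiv ℝ (fun x : V ↦ χ (a n • x)) x).smulRight (f x) :=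
      fderiv_fun_smul ((hχd n).differentiable one_ne_zero x) f.differentiableAt
    have h2 : ‖fderiv ℝ (fun x : V ↦ χ (a n • x)) x‖ ≤ a n * K := by
      rw [fderiv_comp_smul, norm_smul, Real.norm_of_nonneg (ha n).le]
      exact mul_le_mul_of_nonneg_left (hK _) (ha n).le
    rw [h1]
    refine (norm_add_le _ _).trans (add_le_add ?_ ?_)
    · rw [norm_smul, Real.norm_of_nonneg χ.nonneg]
      exact mul_le_of_le_one_left (norm_nonneg _) χ.le_one
    · rw [ContinuousLinearMap.norm_smulRight_apply]
      gcongr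
  have hp1 : (1 : ℝ≥0∞) ≤ p := by exact_mod_cast hp
  have hbound : ∀ n, eLpNorm (g n) p' volume ≤
      C * (eLpNorm (fderiv ℝ f) p volume + ‖a n * K‖ₑ * eLpNorm f p volume) := by
    intro n
    refine (eLpNorm_le_eLpNorm_fderiv_of_eq volume (hg n) (hgs n) hp hn (by simpa using hp')).trans ?_
    gcongr
    have h3 : AEStronglyMeasurable (fun x ↦ ‖fderiv ℝ f x‖) volume :=
      ((f.smooth 1).continuous_fderiv one_ne_zero).norm.aestronglyMeasurable
    have h4 : AEStronglyMeasurable ((a n * K) • fun x ↦ ‖f x‖) volume :=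
      (f.continuous.norm.const_smul _).aestronglyMeasurable
    calc eLpNorm (fderiv ℝ (g n)) p volume
        ≤ eLpNorm ((fun x ↦ ‖fderiv ℝ f x‖) + (a n * K) • fun x ↦ ‖f x‖) p volume :=
          eLpNorm_mono_real (fun x ↦ by simpa using hfd n x)
      _ ≤ _ := eLpNorm_add_le h3 h4 hp1
      _ = _ := by rw [eLpNorm_const_smul, eLpNorm_norm, eLpNorm_norm]
  have hfin : eLpNorm f p volume ≠ ⊤ := (f.eLpNorm_lt_top p volume).ne
  have htend : Tendsto (fun n ↦ C * (eLpNorm (fderiv ℝ f) p volume +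
      ‖a n * K‖ₑ * eLpNorm f p volume)) atTop
      (𝓝 (C * (eLpNorm (fderiv ℝ f) p volume + 0))) := by
    refine ENNReal.Tendsto.const_mul (Tendsto.const_add _ ?_) (Or.inr ENNReal.coe_ne_top)
    have h5 : Tendsto (fun n ↦ ‖a n * K‖ₑ) atTop (𝓝 0) := by
      have := ((ha0.mul_const K).enorm)
      simpa using this
    simpa using ENNReal.Tendsto.mul_const h5 (Or.inr hfin)
  rw [add_zero] at htend
  calc eLpNorm f p' volume
      ≤ liminf (fun n ↦ eLpNorm (g n) p' volume) atTop :=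
        Lp.eLpNorm_lim_le_liminf_eLpNorm (fun n ↦ (hg n).continuous.aestronglyMeasurable) _
          (ae_of_all _ hlim)
    _ ≤ liminf (fun n ↦ C * (eLpNorm (fderiv ℝ f) p volume +
          ‖a n * K‖ₑ * eLpNorm f p volume)) atTop :=
        liminf_le_liminf (Eventually.of_forall hbound)
    _ = _ := htend.liminf_eq

end Sobolev

section IteratedDerivatives

variable {V F : Type*} [NormedAddCommGroup V] [InnerProductSpace ℝ V]
  [NormedAddCommGroup F] [NormedSpace ℝ F]

theorem ContinuousMultilinearMap.norm_apply_orthonormalBasis_le {ι : Type*} [Fintype ι]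
    (b : OrthonormalBasis ι ℝ V) {n : ℕ} (M : V [×n]→L[ℝ] F) (I : Fin n → ι) :
    ‖M (b ∘ I)‖ ≤ ‖M‖ := by
  simpa using M.le_opNorm (b ∘ I)

theorem ContinuousMultilinearMap.norm_le_sum_orthonormalBasis {ι : Type*} [Fintype ι]
    (b : OrthonormalBasis ι ℝ V) {n : ℕ} (M : V [×n]→L[ℝ] F) :
    ‖M‖ ≤ ∑ I : Fin n → ι, ‖M (b ∘ I)‖ := by
  classical
  refine M.opNorm_le_bound (by positivity) fun v ↦ ?_
  have hv : v = fun j ↦ ∑ i, b.repr (v j) i • b i := funext fun j ↦ (b.sum_repr (v j)).symm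
  have h1 : M v = ∑ I : Fin n → ι, (∏ j, b.repr (v j) (I j)) • M (b ∘ I) := by
    conv_lhs => rw [hv]
    rw [M.map_sum]
    exact Finset.sum_congr rfl fun I _ ↦ M.map_smul_univ _ _
  rw [h1, Finset.sum_mul]
  refine norm_sum_le_of_le _ fun I _ ↦ ?_
  rw [norm_smul, mul_comm, norm_prod]
  gcongr with j
  simpa [b.repr_apply_apply] using abs_real_inner_le_norm (b (I j)) (v j)

theorem SchwartzMap.lineDerivOp_comm (v w : V) (f : 𝓢(V, F)) : ∂_{v} (∂_{w} f) = ∂_{w} (∂_{v} f) := by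
  ext x
  have hd : DifferentiableAt ℝ (fderiv ℝ f) x :=
    ((f.smooth 2).fderiv_right (m := 1) (by norm_num)).differentiable one_ne_zero x
  have key : ∀ a c : V, (∂_{a} (∂_{c} f) : 𝓢(V, F)) x = fderiv ℝ (fderiv ℝ f) x a c := by
    intro a c
    rw [lineDerivOp_apply_eq_fderiv]
    have : (⇑(∂_{c} f : 𝓢(V, F)) : V → F) = fun y ↦ fderiv ℝ f y c :=
      funext fun y ↦ lineDerivOp_apply_eq_fderiv c f y
    rw [this, fderiv_clm_apply hd (differentiableAt_const c)]
    simp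
  rw [key, key]
  exact ((f.smooth 2).contDiffAt.isSymmSndFDerivAt (by simp)).eq v w

theorem SchwartzMap.lineDerivOp_iteratedLineDerivOp_comm {n : ℕ} (v : V) (m : Fin n → V)
    (f : 𝓢(V, F)) : ∂_{v} (∂^{m} f) = ∂^{m} (∂_{v} f) := by
  induction n with
  | zero => simp
  | succ n ih =>
    rw [LineDeriv.iteratedLineDerivOp_succ_left, LineDeriv.iteratedLineDerivOp_succ_left,
      lineDerivOp_comm, ih]

theorem SchwartzMap.norm_fderiv_iteratedLineDerivOp_le {ι : Type*} [Fintype ι]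
    (b : OrthonormalBasis ι ℝ V) {n : ℕ} (I : Fin n → ι) (f : 𝓢(V, F)) (x : V) :
    ‖fderiv ℝ (∂^{b ∘ I} f : 𝓢(V, F)) x‖ ≤ ‖iteratedFDeriv ℝ (n + 1) f x‖ := by
  refine ContinuousLinearMap.opNorm_le_bound _ (norm_nonneg _) fun v ↦ ?_
  rw [← lineDerivOp_apply_eq_fderiv]
  have : ∂_{v} (∂^{b ∘ I} f) = ∂^{Fin.cons v (b ∘ I)} f := by
    rw [LineDeriv.iteratedLineDerivOp_succ_left]
    simp
  rw [this, iteratedLineDerivOp_eq_iteratedFDeriv]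
  simpa [Fin.prod_univ_succ] using
    (iteratedFDeriv ℝ (n + 1) f x).le_opNorm (Fin.cons v (b ∘ I) : Fin (n + 1) → V)

variable [FiniteDimensional ℝ V] [MeasurableSpace V] [BorelSpace V]

theorem SchwartzMap.aestronglyMeasurable_iteratedFDeriv (f : 𝓢(V, F)) (n : ℕ) :
    AEStronglyMeasurable (iteratedFDeriv ℝ n f) (volume : Measure V) :=
  ((f.smooth n).continuous_iteratedFDeriv le_rfl).aestronglyMeasurable

theorem SchwartzMap.exists_eLpNorm_iteratedFDeriv_le_succ [FiniteDimensional ℝ F] {p p' : ℝ≥0}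
    (hp : 1 ≤ p) (hn : 0 < Module.finrank ℝ V)
    (hp' : (p' : ℝ)⁻¹ = (p : ℝ)⁻¹ - (Module.finrank ℝ V : ℝ)⁻¹) (n : ℕ) :
    ∃ C : ℝ≥0, ∀ f : 𝓢(V, F), eLpNorm (iteratedFDeriv ℝ n f) p' volume ≤
      C * eLpNorm (iteratedFDeriv ℝ (n + 1) f) p volume := by
  set b := stdOrthonormalBasis ℝ V
  set C : ℝ≥0 := SNormLESNormFDerivOfEqConst F (volume : Measure V) p
  by_cases hp'1 : 1 ≤ p'
  swap
  · have hp'0 : p' = 0 := by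
      by_contra h0
      have h1 : (p' : ℝ)⁻¹ ≤ 1 := by
        rw [hp']
        have : (p : ℝ)⁻¹ ≤ 1 := inv_le_one_of_one_le₀ (by exact_mod_cast hp)
        have h2 : 0 ≤ (Module.finrank ℝ V : ℝ)⁻¹ := by positivity
        linarith
      have h3 : 0 < p' := pos_iff_ne_zero.2 h0
      exact hp'1 (by exact_mod_cast (inv_le_one₀ (by exact_mod_cast h3)).1 h1)
    exact ⟨0, fun f ↦ by simp [hp'0]⟩
  refine ⟨(Fintype.card (Fin n → Fin (Module.finrank ℝ V)) : ℝ≥0) * C, fun f ↦ ?_⟩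
  have h1 : ∀ I : Fin n → Fin (Module.finrank ℝ V), eLpNorm (∂^{b ∘ I} f : 𝓢(V, F)) p' volume ≤
      C * eLpNorm (iteratedFDeriv ℝ (n + 1) f) p volume := fun I ↦
    ((∂^{b ∘ I} f : 𝓢(V, F)).eLpNorm_le_eLpNorm_fderiv hp hn hp').trans (by
      gcongr
      exact eLpNorm_mono fun x ↦ norm_fderiv_iteratedLineDerivOp_le b I f x)
  calc eLpNorm (iteratedFDeriv ℝ n f) p' volume
      ≤ eLpNorm (∑ I : Fin n → Fin (Module.finrank ℝ V), fun x ↦ ‖(∂^{b ∘ I} f : 𝓢(V, F)) x‖) p' volume := by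
        refine eLpNorm_mono_real fun x ↦ ?_
        simpa [iteratedLineDerivOp_eq_iteratedFDeriv] using
          (iteratedFDeriv ℝ n f x).norm_le_sum_orthonormalBasis b
    _ ≤ ∑ I : Fin n → Fin (Module.finrank ℝ V), eLpNorm (fun x ↦ ‖(∂^{b ∘ I} f : 𝓢(V, F)) x‖) p' volume :=
        eLpNorm_sum_le (fun I _ ↦ (∂^{b ∘ I} f : 𝓢(V, F)).continuous.norm.aestronglyMeasurable)
          (by exact_mod_cast hp'1)
    _ ≤ ∑ I : Fin n → Fin (Module.finrank ℝ V),
          C * eLpNorm (iteratedFDeriv ℝ (n + 1) f) p volume :=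
        Finset.sum_le_sum fun I _ ↦ by rw [eLpNorm_norm]; exact h1 I
    _ = _ := by
        rw [Finset.sum_const, Finset.card_univ, nsmul_eq_mul]
        push_cast
        ring

theorem SchwartzMap.exists_eLpNorm_iteratedFDeriv_le [FiniteDimensional ℝ F]
    (hn : 0 < Module.finrank ℝ V) {p : ℝ≥0} (hp : 1 ≤ p) (i : ℕ) :
    ∀ (n : ℕ) (p' : ℝ≥0), (p' : ℝ)⁻¹ = (p : ℝ)⁻¹ - i / Module.finrank ℝ V →
    ∃ C : ℝ≥0, ∀ f : 𝓢(V, F), eLpNorm (iteratedFDeriv ℝ n f) p' volume ≤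
      C * eLpNorm (iteratedFDeriv ℝ (n + i) f) p volume := by
  induction i with
  | zero =>
    intro n p' hp'
    have : p' = p := by simpa using hp'
    exact ⟨1, fun f ↦ by simp [this]⟩
  | succ i ih =>
    intro n p' hp'
    have hd : 0 < (Module.finrank ℝ V : ℝ) := by exact_mod_cast hn
    set q : ℝ≥0 := (p'⁻¹ + (Module.finrank ℝ V : ℝ≥0)⁻¹)⁻¹ with hq
    have hqi : (q : ℝ)⁻¹ = (p' : ℝ)⁻¹ + (Module.finrank ℝ V : ℝ)⁻¹ := by simp [hq]
    have hq1 : (q : ℝ)⁻¹ = (p : ℝ)⁻¹ - i / Module.finrank ℝ V := by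
      rw [hqi, hp']; push_cast; field_simp; ring
    have hq0 : 0 < (q : ℝ)⁻¹ := by rw [hqi]; positivity
    have hq2 : 1 ≤ q := by
      have : (q : ℝ)⁻¹ ≤ 1 := by
        rw [hq1]
        have : (p : ℝ)⁻¹ ≤ 1 := inv_le_one_of_one_le₀ (by exact_mod_cast hp)
        have h2 : 0 ≤ (i : ℝ) / Module.finrank ℝ V := by positivity
        linarith
      exact_mod_cast (inv_le_one₀ (inv_pos.1 hq0)).1 this
    obtain ⟨C₁, h₁⟩ := exists_eLpNorm_iteratedFDeriv_le_succ (F := F) hq2 hn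
      (p' := p') (by rw [hqi]; ring) n
    obtain ⟨C₂, h₂⟩ := ih (n + 1) q hq1
    refine ⟨C₁ * C₂, fun f ↦ (h₁ f).trans ?_⟩
    rw [ENNReal.coe_mul, mul_assoc, show n + (i + 1) = n + 1 + i by ring]
    gcongr
    exact h₂ f

end IteratedDerivatives

section Transport

variable {V : Type*} [NormedAddCommGroup V] [InnerProductSpace ℝ V]

theorem norm_iteratedFDeriv_fderiv_apply_sub_le {E F : Type*} [NormedAddCommGroup E]
    [NormedSpace ℝ E] [NormedAddCommGroup F] [NormedSpace ℝ F] {h : E → F} {u : E → E}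
    (hh : ContDiff ℝ (⊤ : ℕ∞) h) (hu : ContDiff ℝ (⊤ : ℕ∞) u) (m : ℕ) (x : E) :
    ‖iteratedFDeriv ℝ m (fun y ↦ fderiv ℝ h y (u y)) x -
      iteratedFDeriv ℝ m (fun y ↦ fderiv ℝ h y (u x)) x‖ ≤
    ∑ i ∈ Finset.range m, (m.choose i : ℝ) * ‖iteratedFDeriv ℝ (i + 1) h x‖ *
      ‖iteratedFDeriv ℝ (m - i) u x‖ := by
  have hm : (m : WithTop ℕ∞) ≤ ((⊤ : ℕ∞) : WithTop ℕ∞) := by exact_mod_cast le_top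
  have hDh : ContDiff ℝ m (fderiv ℝ h) := (hh.fderiv_right (m := (⊤ : ℕ∞)) (by simp)).of_le hm
  have hum : ContDiff ℝ m u := hu.of_le hm
  have e : (fun y ↦ fderiv ℝ h y (u y - u x)) =
      (fun y ↦ fderiv ℝ h y (u y)) - fun y ↦ fderiv ℝ h y (u x) := by
    ext y; simp
  rw [← iteratedFDeriv_sub_apply (hDh.clm_apply hum).contDiffAt
    (hDh.clm_apply contDiff_const).contDiffAt, ← e]
  refine (norm_iteratedFDeriv_clm_apply (N := m) hDh
    (hum.sub contDiff_const) x le_rfl).trans ?_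
  rw [Finset.sum_range_succ]
  have h0 : ∀ n, n = 0 → ‖iteratedFDeriv ℝ n (fun y ↦ u y - u x) x‖ = 0 := by
    rintro _ rfl
    simp
  rw [h0 _ (Nat.sub_self m), mul_zero, add_zero]
  refine Finset.sum_le_sum fun i hi ↦ ?_
  have hi' : m - i ≠ 0 := by have := Finset.mem_range.1 hi; omega
  rw [norm_iteratedFDeriv_fderiv]
  have : iteratedFDeriv ℝ (m - i) (fun y ↦ u y - u x) x = iteratedFDeriv ℝ (m - i) u x := by
    have e2 : (fun y ↦ u y - u x) = u - fun _ ↦ u x := rfl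
    rw [e2, iteratedFDeriv_sub_apply (hum.of_le (by exact_mod_cast Nat.sub_le _ _)).contDiffAt
      contDiff_const.contDiffAt, iteratedFDeriv_const_of_ne hi']
    simp
  rw [this]

/-- The Schwartz function `x ↦ Dh(x) u(x)`. -/
def SchwartzMap.transport (u : 𝓢(V, V)) (h : 𝓢(V, ℂ)) : 𝓢(V, ℂ) :=
  bilinLeftCLM (ContinuousLinearMap.id ℝ (V →L[ℝ] ℂ)) u.hasTemperateGrowth (fderivCLM ℝ V ℂ h)

@[simp]
theorem SchwartzMap.transport_apply (u : 𝓢(V, V)) (h : 𝓢(V, ℂ)) (x : V) :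
    transport u h x = fderiv ℝ h x (u x) := rfl

theorem SchwartzMap.norm_iteratedLineDerivOp_transport_sub_le {ι : Type*} [Fintype ι]
    (b : OrthonormalBasis ι ℝ V) {m : ℕ} (I : Fin m → ι) (u : 𝓢(V, V)) (h : 𝓢(V, ℂ)) (x : V) :
    ‖(∂^{b ∘ I} (transport u h) : 𝓢(V, ℂ)) x - transport u (∂^{b ∘ I} h) x‖ ≤
    ∑ i ∈ Finset.range m, (m.choose i : ℝ) * ‖iteratedFDeriv ℝ (i + 1) h x‖ *
      ‖iteratedFDeriv ℝ (m - i) u x‖ := by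
  refine le_trans ?_ (norm_iteratedFDeriv_fderiv_apply_sub_le (h.smooth ⊤) (u.smooth ⊤) m x)
  refine le_trans (le_of_eq ?_) (ContinuousMultilinearMap.norm_apply_orthonormalBasis_le b _ I)
  rw [_root_.sub_apply]
  congr 2
  · rw [iteratedLineDerivOp_eq_iteratedFDeriv]
    rfl
  · rw [transport_apply, ← lineDerivOp_apply_eq_fderiv, lineDerivOp_iteratedLineDerivOp_comm,
      iteratedLineDerivOp_eq_iteratedFDeriv]
    rfl

variable [FiniteDimensional ℝ V] [MeasurableSpace V] [BorelSpace V]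

theorem SchwartzMap.abs_integral_inner_transport_self_le (u : 𝓢(V, V)) (g : 𝓢(V, ℂ)) {M : ℝ}
    (hM : ∀ x, ‖fderiv ℝ u x‖ ≤ M) :
    |∫ x, inner ℝ (g x) (transport u g x)| ≤ Module.finrank ℝ V * M * ∫ x, ‖g x‖ ^ 2 := by
  set b := stdOrthonormalBasis ℝ V
  set φ : 𝓢(V, ℝ) := bilinLeftCLM (innerSL ℝ) g.hasTemperateGrowth g
  have hφ : ∀ x, φ x = ‖g x‖ ^ 2 := fun x ↦ real_inner_self_eq_norm_sq (g x)
  have hφ' : ∀ x v, fderiv ℝ φ x v = 2 * inner ℝ (g x) (fderiv ℝ g x v) := by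
    intro x v
    rw [show (φ : V → ℝ) = fun x ↦ ‖g x‖ ^ 2 from funext hφ,
      (g.differentiableAt.hasFDerivAt.norm_sq).fderiv]
    simp [mul_add]
  let L (i) : ℝ →L[ℝ] V →L[ℝ] ℝ := (ContinuousLinearMap.id ℝ ℝ).smulRight (innerSL ℝ (b i))
  have hL : ∀ i c v, L i c v = c * inner ℝ (b i) v := fun i c v ↦ by simp [L]
  have hInt : ∀ i, Integrable (fun x ↦ L i ((∂_{b i} φ : 𝓢(V, ℝ)) x) (u x)) := fun i ↦
    (bilinLeftCLM (L i) u.hasTemperateGrowth (∂_{b i} φ : 𝓢(V, ℝ))).integrable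
  have key : 2 * ∫ x, inner ℝ (g x) (transport u g x) =
      ∑ i, -∫ x, L i (φ x) ((∂_{b i} u : 𝓢(V, V)) x) := by
    have h1 : ∀ i, -∫ x, L i (φ x) ((∂_{b i} u : 𝓢(V, V)) x) =
        ∫ x, L i ((∂_{b i} φ : 𝓢(V, ℝ)) x) (u x) := fun i ↦ by
      rw [integral_bilinear_lineDerivOp_right_eq_neg_left φ u (L i) (b i), neg_neg]
    simp_rw [h1]
    rw [← integral_const_mul, ← integral_finsetSum _ fun i _ ↦ hInt i]
    congr 1 with x
    simp only [transport_apply, ← hφ', hL, lineDerivOp_apply_eq_fderiv]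
    conv_lhs => rw [← b.sum_repr' (u x)]
    simp [mul_comm]
  have hb : ∀ i, |∫ x, L i (φ x) ((∂_{b i} u : 𝓢(V, V)) x)| ≤ M * ∫ x, ‖g x‖ ^ 2 := by
    intro i
    rw [← integral_const_mul]
    have hgi : Integrable fun x ↦ M * ‖g x‖ ^ 2 := by
      have := φ.integrable (μ := volume)
      rw [show (φ : V → ℝ) = fun x ↦ ‖g x‖ ^ 2 from funext hφ] at this
      exact this.const_mul M
    rw [← Real.norm_eq_abs]
    refine norm_integral_le_of_norm_le hgi (Eventually.of_forall fun x ↦ ?_)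
    rw [hL, hφ, norm_mul, norm_pow, norm_norm, mul_comm, lineDerivOp_apply_eq_fderiv]
    gcongr
    calc ‖inner ℝ (b i) (fderiv ℝ u x (b i))‖ ≤ ‖b i‖ * ‖fderiv ℝ u x (b i)‖ :=
          norm_inner_le_norm _ _
      _ ≤ ‖b i‖ * (‖fderiv ℝ u x‖ * ‖b i‖) := by gcongr; exact (fderiv ℝ u x).le_opNorm _
      _ ≤ M := by simpa using hM x
  have h2 : |2 * ∫ x, inner ℝ (g x) (transport u g x)| ≤
      Module.finrank ℝ V * M * ∫ x, ‖g x‖ ^ 2 := by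
    rw [key]
    refine (Finset.abs_sum_le_sum_abs _ _).trans ?_
    simp_rw [abs_neg]
    refine (Finset.sum_le_sum fun i _ ↦ hb i).trans_eq ?_
    simp [mul_assoc]
  rw [abs_mul, abs_two] at h2
  linarith [abs_nonneg (∫ x, inner ℝ (g x) (transport u g x))]

end Transport

section Commutator

theorem MeasureTheory.MemLp.integrable_norm_mul_norm {X E F : Type*} [MeasurableSpace X]
    [NormedAddCommGroup E] [NormedAddCommGroup F] {ν : Measure X} {f : X → E} {g : X → F}
    (hf : MemLp f 2 ν) (hg : MemLp g 2 ν) : Integrable (fun x ↦ ‖f x‖ * ‖g x‖) ν :=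
  MemLp.integrable_mul hf.norm hg.norm

theorem MeasureTheory.MemLp.integral_norm_mul_norm_le {X E F : Type*} [MeasurableSpace X]
    [NormedAddCommGroup E] [NormedAddCommGroup F] {ν : Measure X} {f : X → E} {g : X → F}
    (hf : MemLp f 2 ν) (hg : MemLp g 2 ν) :
    ∫ x, ‖f x‖ * ‖g x‖ ∂ν ≤ (eLpNorm f 2 ν).toReal * (eLpNorm g 2 ν).toReal := by
  have h1 : ∫ x, ‖f x‖ * ‖g x‖ ∂ν = (eLpNorm (fun x ↦ ‖f x‖ * ‖g x‖) 1 ν).toReal := by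
    rw [eLpNorm_one_eq_lintegral_enorm, ← integral_norm_eq_lintegral_enorm
      (hf.integrable_norm_mul_norm hg).aestronglyMeasurable]
    simp
  rw [h1, ← ENNReal.toReal_mul]
  refine ENNReal.toReal_mono (ENNReal.mul_ne_top hf.2.ne hg.2.ne) ?_
  have := eLpNorm_smul_le_mul_eLpNorm (p := 2) (q := 2) (r := 1) hg.1.norm hf.1.norm
  simpa [Pi.mul_def] using this

variable {V : Type*} [NormedAddCommGroup V] [InnerProductSpace ℝ V]
  [FiniteDimensional ℝ V] [MeasurableSpace V] [BorelSpace V]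

theorem SchwartzMap.memLp_iteratedFDeriv {F : Type*} [NormedAddCommGroup F] [NormedSpace ℝ F]
    (f : 𝓢(V, F)) (n : ℕ) (p : ℝ≥0∞) :
    MemLp (iteratedFDeriv ℝ n f) p (volume : Measure V) := by
  set b := stdOrthonormalBasis ℝ V
  have h : MemLp (∑ I : Fin n → Fin (Module.finrank ℝ V),
      fun x ↦ ‖(∂^{b ∘ I} f : 𝓢(V, F)) x‖) p (volume : Measure V) :=
    memLp_finsetSum' _ fun I _ ↦ ((∂^{b ∘ I} f : 𝓢(V, F)).memLp p volume).norm
  refine h.mono (f.aestronglyMeasurable_iteratedFDeriv n) (Eventually.of_forall fun x ↦ ?_)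
  refine le_trans ?_ (Real.le_norm_self _)
  simpa [iteratedLineDerivOp_eq_iteratedFDeriv] using
    (iteratedFDeriv ℝ n f x).norm_le_sum_orthonormalBasis b

theorem SchwartzMap.exists_eLpNorm_mul_iteratedFDeriv_le {k m i : ℕ} (hk : 0 < k)
    (hkd : 2 * k < Module.finrank ℝ V) (hm : m ≤ k + 1) (hi : i < m) :
    ∃ C : ℝ≥0, ∀ (u : 𝓢(V, V)) (h : 𝓢(V, ℂ)) (M : ℝ), (∀ x, ‖fderiv ℝ u x‖ ≤ M) →
      eLpNorm (fun x ↦ ‖iteratedFDeriv ℝ (i + 1) h x‖ * ‖iteratedFDeriv ℝ (m - i) u x‖) 2 volume ≤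
      C * (ENNReal.ofReal M + eLpNorm (iteratedFDeriv ℝ (k + 1) u)
        ((Module.finrank ℝ V : ℝ≥0) / k : ℝ≥0) volume) *
        eLpNorm (iteratedFDeriv ℝ m h) 2 volume := by
  set d := Module.finrank ℝ V
  obtain ⟨l, rfl⟩ : ∃ l, m = i + 1 + l := ⟨m - (i + 1), by omega⟩
  have hml : i + 1 + l - i = l + 1 := by omega
  rw [hml]
  have hd : 0 < d := by omega
  rcases Nat.eq_zero_or_pos l with rfl | hl
  · refine ⟨1, fun u h M hM ↦ ?_⟩
    have h1 : eLpNorm (fun x ↦ ‖iteratedFDeriv ℝ (i + 1) h x‖ *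
        ‖iteratedFDeriv ℝ (0 + 1) u x‖) 2 volume ≤
        ENNReal.ofReal M * eLpNorm (iteratedFDeriv ℝ (i + 1) h) 2 volume := by
      refine eLpNorm_le_mul_eLpNorm_of_ae_le_mul (Eventually.of_forall fun x ↦ ?_) 2
      rw [norm_mul, norm_norm, norm_norm, mul_comm, zero_add, norm_iteratedFDeriv_one]
      gcongr
      exact hM x
    refine h1.trans ?_
    rw [ENNReal.coe_one, one_mul]
    gcongr
    exact le_self_add
  · set p : ℝ≥0 := (d : ℝ≥0) / k
    set q : ℝ≥0 := (d : ℝ≥0) / l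
    set r : ℝ≥0 := ((2 : ℝ≥0)⁻¹ - (l : ℝ≥0) / d)⁻¹
    have hdR : (0 : ℝ) < d := by exact_mod_cast hd
    have hkR : (0 : ℝ) < k := by exact_mod_cast hk
    have hlR : (0 : ℝ) < l := by exact_mod_cast hl
    have hkdR : (2 : ℝ) * k < d := by exact_mod_cast hkd
    have hlk : (l : ℝ) ≤ k := by exact_mod_cast (show l ≤ k by omega)
    have hld : (l : ℝ≥0) / d ≤ 2⁻¹ := by
      rw [← NNReal.coe_le_coe]
      push_cast
      rw [div_le_iff₀ hdR]
      linarith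
    have hr : (r : ℝ)⁻¹ = 2⁻¹ - l / d := by
      simp [r, NNReal.coe_sub hld]
    have hp1 : 1 ≤ p := by
      rw [← NNReal.coe_le_coe]
      simp only [p]
      push_cast
      rw [le_div_iff₀ hkR]
      linarith
    have hq : (q : ℝ)⁻¹ = (p : ℝ)⁻¹ - (k - l : ℕ) / d := by
      rw [Nat.cast_sub (by omega)]
      simp only [p, q]
      push_cast
      field_simp
      ring
    have hrpos : 0 < r := by
      rw [← NNReal.coe_pos, ← inv_pos, hr]
      rw [sub_pos, div_lt_iff₀ hdR]
      linarith
    have hqpos : 0 < q := by positivity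
    have hT : ENNReal.HolderTriple (r : ℝ≥0∞) q 2 := by
      constructor
      rw [← ENNReal.coe_inv hrpos.ne', ← ENNReal.coe_inv hqpos.ne', ← ENNReal.coe_add,
        show ((2 : ℝ≥0∞)⁻¹) = ((2⁻¹ : ℝ≥0) : ℝ≥0∞) by simp]
      congr 1
      rw [← NNReal.coe_inj]
      push_cast
      rw [hr]
      simp [q]
    obtain ⟨C₁, h₁⟩ := exists_eLpNorm_iteratedFDeriv_le (V := V) (F := V) hd hp1 (k - l) (l + 1) q hq
    obtain ⟨C₂, h₂⟩ := exists_eLpNorm_iteratedFDeriv_le (V := V) (F := ℂ) hd (p := 2) (by norm_num)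
      l (i + 1) r (by simpa using hr)
    refine ⟨C₂ * C₁, fun u h M hM ↦ ?_⟩
    have h3 : eLpNorm (fun x ↦ ‖iteratedFDeriv ℝ (i + 1) h x‖ *
        ‖iteratedFDeriv ℝ (l + 1) u x‖) 2 volume ≤
        eLpNorm (iteratedFDeriv ℝ (i + 1) h) r volume *
        eLpNorm (iteratedFDeriv ℝ (l + 1) u) q volume := by
      have := eLpNorm_smul_le_mul_eLpNorm (p := (r : ℝ≥0∞)) (q := q) (r := 2)
        (u.aestronglyMeasurable_iteratedFDeriv (l + 1)).norm
        (h.aestronglyMeasurable_iteratedFDeriv (i + 1)).norm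
      simpa [Pi.mul_def] using this
    have h4 := h₁ u
    rw [show l + 1 + (k - l) = k + 1 by omega] at h4
    calc _ ≤ _ := h3
      _ ≤ (C₂ * eLpNorm (iteratedFDeriv ℝ (i + 1 + l) h) (2 : ℝ≥0) volume) *
          (C₁ * eLpNorm (iteratedFDeriv ℝ (k + 1) u) p volume) := by
        gcongr
        exact h₂ h
      _ ≤ (C₂ * eLpNorm (iteratedFDeriv ℝ (i + 1 + l) h) (2 : ℝ≥0) volume) *
          (C₁ * (ENNReal.ofReal M + eLpNorm (iteratedFDeriv ℝ (k + 1) u) p volume)) := by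
        gcongr
        exact le_add_self
      _ = _ := by
        rw [ENNReal.coe_mul, ENNReal.coe_ofNat]
        ring

theorem SchwartzMap.exists_abs_sum_integral_inner_transport_le (k m : ℕ) (hk : 0 < k)
    (hkd : 2 * k < Module.finrank ℝ V) (hm : m ≤ k + 1) {ι : Type*} [Fintype ι]
    (b : OrthonormalBasis ι ℝ V) :
    ∃ C : ℝ, 0 ≤ C ∧ ∀ (u : 𝓢(V, V)) (h : 𝓢(V, ℂ)) (M : ℝ), (∀ x, ‖fderiv ℝ u x‖ ≤ M) →
      |∑ I : Fin m → ι, ∫ x, inner ℝ ((∂^{b ∘ I} h : 𝓢(V, ℂ)) x)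
        ((∂^{b ∘ I} (transport u h) : 𝓢(V, ℂ)) x)| ≤
      C * (M + (eLpNorm (iteratedFDeriv ℝ (k + 1) u)
        ((Module.finrank ℝ V : ℝ≥0) / k : ℝ≥0) volume).toReal) *
        ∑ I : Fin m → ι, ∫ x, ‖(∂^{b ∘ I} h : 𝓢(V, ℂ)) x‖ ^ 2 := by
  set d := Module.finrank ℝ V
  set p : ℝ≥0 := (d : ℝ≥0) / k
  have hdR : (0 : ℝ) < d := by exact_mod_cast (show 0 < d by omega)
  have hC : ∀ i : ℕ, ∃ C : ℝ≥0, i < m → ∀ (u : 𝓢(V, V)) (h : 𝓢(V, ℂ)) (M : ℝ),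
      (∀ x, ‖fderiv ℝ u x‖ ≤ M) →
      eLpNorm (fun x ↦ ‖iteratedFDeriv ℝ (i + 1) h x‖ * ‖iteratedFDeriv ℝ (m - i) u x‖) 2 volume ≤
      C * (ENNReal.ofReal M + eLpNorm (iteratedFDeriv ℝ (k + 1) u) p volume) *
        eLpNorm (iteratedFDeriv ℝ m h) 2 volume := fun i ↦ by
    by_cases hi : i < m
    · obtain ⟨C, hC⟩ := exists_eLpNorm_mul_iteratedFDeriv_le (V := V) hk hkd hm hi
      exact ⟨C, fun _ ↦ hC⟩
    · exact ⟨0, fun h ↦ (hi h).elim⟩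
  choose C hC using hC
  set N : ℝ := (Fintype.card (Fin m → ι) : ℝ)
  set C₀ : ℝ := ∑ i ∈ Finset.range m, (m.choose i : ℝ) * C i
  refine ⟨d + N * (C₀ * N), by positivity, fun u h M hM ↦ ?_⟩
  have hM0 : 0 ≤ M := (norm_nonneg _).trans (hM 0)
  set S : ℝ := (eLpNorm (iteratedFDeriv ℝ (k + 1) u) p volume).toReal with hS
  have hS0 : 0 ≤ S := ENNReal.toReal_nonneg
  have hSfin : eLpNorm (iteratedFDeriv ℝ (k + 1) u) p volume ≠ ⊤ :=
    (u.memLp_iteratedFDeriv (k + 1) p).2.ne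
  set A : ℝ := (eLpNorm (iteratedFDeriv ℝ m h) 2 volume).toReal with hA
  have hAm : MemLp (iteratedFDeriv ℝ m h) 2 (volume : Measure V) :=
    h.memLp_iteratedFDeriv m 2
  let T (i : ℕ) (x : V) : ℝ :=
    ‖iteratedFDeriv ℝ (i + 1) h x‖ * ‖iteratedFDeriv ℝ (m - i) u x‖
  have hTle : ∀ i < m, eLpNorm (T i) 2 volume ≤
      ENNReal.ofReal (C i * (M + S) * A) := by
    intro i hi
    refine (hC i hi u h M hM).trans_eq ?_
    rw [ENNReal.ofReal_mul (by positivity), ENNReal.ofReal_mul (by positivity),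
      ENNReal.ofReal_add hM0 hS0, hS, hA, ENNReal.ofReal_toReal hSfin,
      ENNReal.ofReal_toReal hAm.2.ne, ENNReal.ofReal_coe_nnreal]
  have hT : ∀ i < m, MemLp (T i) 2 (volume : Measure V) := fun i hi ↦
    ⟨(h.aestronglyMeasurable_iteratedFDeriv (i + 1)).norm.mul
      (u.aestronglyMeasurable_iteratedFDeriv (m - i)).norm,
      (hTle i hi).trans_lt ENNReal.ofReal_lt_top⟩
  let g (I : Fin m → ι) : 𝓢(V, ℂ) := ∂^{b ∘ I} h
  have hg : ∀ I, MemLp (g I) 2 (volume : Measure V) := fun I ↦ (g I).memLp 2 volume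
  have hgA : ∀ I, (eLpNorm (g I) 2 volume).toReal ≤ A := fun I ↦ by
    refine ENNReal.toReal_mono hAm.2.ne (eLpNorm_mono fun x ↦ ?_)
    simp only [g, iteratedLineDerivOp_eq_iteratedFDeriv]
    exact ContinuousMultilinearMap.norm_apply_orthonormalBasis_le b _ I
  set D : ℝ := ∑ I : Fin m → ι, ∫ x, ‖g I x‖ ^ 2 with hD
  have hgsq : ∀ I, Integrable (fun x ↦ ‖g I x‖ ^ 2) := fun I ↦ by
    simpa using (hg I).integrable_norm_pow (p := 2) (by norm_num)
  have hA2 : A ^ 2 ≤ N * D := by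
    have h1 : A ^ 2 = ∫ x, ‖iteratedFDeriv ℝ m h x‖ ^ 2 := by
      rw [hA, hAm.eLpNorm_eq_integral_rpow_norm (by norm_num) (by norm_num),
        ENNReal.toReal_ofReal (by positivity), ENNReal.toReal_ofNat,
        ← Real.rpow_natCast, ← Real.rpow_mul (by positivity)]
      simp
    rw [h1, hD, ← integral_finsetSum _ fun I _ ↦ hgsq I, ← integral_const_mul]
    refine integral_mono (by simpa using hAm.integrable_norm_pow (p := 2) (by norm_num))
      ((integrable_finsetSum _ fun I _ ↦ hgsq I).const_mul _) fun x ↦ ?_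
    have h2 : ‖iteratedFDeriv ℝ m h x‖ ≤ ∑ I, ‖g I x‖ := by
      simpa [g, iteratedLineDerivOp_eq_iteratedFDeriv] using
        (iteratedFDeriv ℝ m h x).norm_le_sum_orthonormalBasis b
    calc ‖iteratedFDeriv ℝ m h x‖ ^ 2 ≤ (∑ I, ‖g I x‖) ^ 2 := by gcongr
      _ ≤ N * ∑ I, ‖g I x‖ ^ 2 := by
        simpa [N] using sq_sum_le_card_mul_sum_sq (s := Finset.univ) (f := fun I ↦ ‖g I x‖)
  have hI : ∀ I, |∫ x, inner ℝ (g I x) ((∂^{b ∘ I} (transport u h) : 𝓢(V, ℂ)) x)| ≤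
      (d * M * ∫ x, ‖g I x‖ ^ 2) + C₀ * (M + S) * A ^ 2 := by
    intro I
    have hi1 : ∀ w : 𝓢(V, ℂ), Integrable fun x ↦ inner ℝ (g I x) (w x) := fun w ↦
      (bilinLeftCLM (innerSL ℝ) w.hasTemperateGrowth (g I)).integrable
    have h1 : ∫ x, inner ℝ (g I x) ((∂^{b ∘ I} (transport u h) : 𝓢(V, ℂ)) x) =
        (∫ x, inner ℝ (g I x) (transport u (g I) x)) +
        ∫ x, inner ℝ (g I x) ((∂^{b ∘ I} (transport u h) : 𝓢(V, ℂ)) x - transport u (g I) x) := by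
      have h2 := hi1 ((∂^{b ∘ I} (transport u h) : 𝓢(V, ℂ)) - transport u (g I))
      simp only [_root_.sub_apply] at h2
      rw [← integral_add (hi1 _) h2]
      congr 1 with x
      rw [← inner_add_right]
      simp
    rw [h1]
    refine (abs_add_le _ _).trans (add_le_add
      (abs_integral_inner_transport_self_le u (g I) hM) ?_)
    have hInt : ∀ i ∈ Finset.range m, Integrable fun x ↦ (m.choose i : ℝ) * (‖g I x‖ * ‖T i x‖) :=
      fun i hi ↦ ((hg I).integrable_norm_mul_norm (hT i (Finset.mem_range.1 hi))).const_mul _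
    rw [← Real.norm_eq_abs]
    refine (norm_integral_le_of_norm_le (integrable_finsetSum _ hInt)
      (Eventually.of_forall fun x ↦ ?_)).trans ?_
    · refine (norm_inner_le_norm _ _).trans ?_
      refine (mul_le_mul_of_nonneg_left
        (norm_iteratedLineDerivOp_transport_sub_le b I u h x) (norm_nonneg _)).trans_eq ?_
      rw [Finset.mul_sum]
      refine Finset.sum_congr rfl fun i _ ↦ ?_
      simp only [T, norm_mul, norm_norm]
      ring
    · rw [integral_finsetSum _ hInt, Finset.sum_mul, Finset.sum_mul]
      refine Finset.sum_le_sum fun i hi ↦ ?_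
      have hi' := Finset.mem_range.1 hi
      rw [integral_const_mul]
      have h2 : (eLpNorm (T i) 2 volume).toReal ≤ C i * (M + S) * A :=
        ENNReal.toReal_le_of_le_ofReal (by positivity) (hTle i hi')
      calc (m.choose i : ℝ) * ∫ x, ‖g I x‖ * ‖T i x‖
          ≤ (m.choose i : ℝ) * (A * (C i * (M + S) * A)) := by
            gcongr
            refine ((hg I).integral_norm_mul_norm_le (hT i hi')).trans ?_
            gcongr
            exact hgA I
        _ = _ := by ring
  have hC₀ : 0 ≤ C₀ := by positivity
  have hD0 : 0 ≤ D := by positivity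
  calc |∑ I, ∫ x, inner ℝ (g I x) ((∂^{b ∘ I} (transport u h) : 𝓢(V, ℂ)) x)|
      ≤ ∑ I, (d * M * (∫ x, ‖g I x‖ ^ 2) + C₀ * (M + S) * A ^ 2) :=
        (Finset.abs_sum_le_sum_abs _ _).trans (Finset.sum_le_sum fun I _ ↦ hI I)
    _ = d * M * D + N * (C₀ * (M + S) * A ^ 2) := by
        rw [Finset.sum_add_distrib, ← Finset.mul_sum, Finset.sum_const, Finset.card_univ,
          nsmul_eq_mul]
    _ ≤ d * (M + S) * D + N * (C₀ * (M + S) * (N * D)) := by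
        gcongr
        linarith
    _ = _ := by ring

end Commutator

section Plancherel

variable {V : Type*} [NormedAddCommGroup V] [InnerProductSpace ℝ V]
  [FiniteDimensional ℝ V] [MeasurableSpace V] [BorelSpace V]

theorem SchwartzMap.fourier_lineDerivOp_apply (v : V) (f : 𝓢(V, ℂ)) (ξ : V) :
    𝓕 (∂_{v} f : 𝓢(V, ℂ)) ξ = (2 * Real.pi * Complex.I) * (inner ℝ ξ v : ℝ) * 𝓕 f ξ := by
  have h : (inner ℝ · v : V → ℝ).HasTemperateGrowth := ((innerSL ℝ).flip v).hasTemperateGrowth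
  rw [fourier_lineDerivOp_eq]
  simp [smulLeftCLM_apply_apply h, mul_assoc]

theorem SchwartzMap.fourier_iteratedLineDerivOp_apply {m : ℕ} (v : Fin m → V) (f : 𝓢(V, ℂ))
    (ξ : V) : 𝓕 (∂^{v} f : 𝓢(V, ℂ)) ξ =
      (2 * Real.pi * Complex.I) ^ m * ((∏ j, inner ℝ ξ (v j) : ℝ) : ℂ) * 𝓕 f ξ := by
  induction m with
  | zero => simp
  | succ m ih =>
    rw [LineDeriv.iteratedLineDerivOp_succ_left, fourier_lineDerivOp_apply, ih,
      Fin.prod_univ_succ]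
    simp only [Fin.tail]
    push_cast
    ring

theorem SchwartzMap.sum_inner_fourier_iteratedLineDerivOp {ι : Type*} [Fintype ι]
    (b : OrthonormalBasis ι ℝ V) (m : ℕ) (f g : 𝓢(V, ℂ)) (ξ : V) :
    ∑ I : Fin m → ι, inner ℂ (𝓕 (∂^{b ∘ I} f : 𝓢(V, ℂ)) ξ) (𝓕 (∂^{b ∘ I} g : 𝓢(V, ℂ)) ξ) =
      (((2 * Real.pi) ^ (2 * m) * ‖ξ‖ ^ (2 * m) : ℝ) : ℂ) * inner ℂ (𝓕 f ξ) (𝓕 g ξ) := by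
  classical
  have h1 : ∑ I : Fin m → ι, (∏ j, inner ℝ ξ (b (I j))) ^ 2 = ‖ξ‖ ^ (2 * m) := by
    have h2 : ‖ξ‖ ^ 2 = ∑ i, inner ℝ ξ (b i) ^ 2 := (b.sum_sq_inner_left ξ).symm
    rw [pow_mul, h2, ← Fin.prod_const, Finset.prod_univ_sum, Fintype.piFinset_univ]
    simp_rw [← Finset.prod_pow]
  rw [← h1]
  push_cast
  rw [Finset.mul_sum, Finset.sum_mul]
  refine Finset.sum_congr rfl fun I _ ↦ ?_
  rw [fourier_iteratedLineDerivOp_apply, fourier_iteratedLineDerivOp_apply]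
  simp only [RCLike.inner_apply, map_mul, map_pow, Complex.conj_ofReal, Complex.conj_I, map_ofNat]
  have h3 : Complex.I ^ m * (-Complex.I) ^ m = 1 := by
    rw [← mul_pow]; simp
  simp only [Function.comp_apply]
  generalize -Complex.I = J at h3 ⊢
  push_cast
  linear_combination (2 * (Real.pi : ℂ)) ^ (2 * m) * (∏ j, (inner ℝ ξ (b (I j)) : ℂ)) ^ 2 *
    (𝓕 g ξ) * (starRingEnd ℂ) (𝓕 f ξ) * h3

theorem SchwartzMap.integrable_inner (f g : 𝓢(V, ℂ)) :
    Integrable (fun x ↦ inner ℂ (f x) (g x)) :=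
  ((f.memLp 2 volume).integrable_norm_mul_norm (g.memLp 2 volume)).mono'
    (f.continuous.inner g.continuous).aestronglyMeasurable
    (Eventually.of_forall fun _ ↦ norm_inner_le_norm _ _)

theorem SchwartzMap.sum_integral_inner_iteratedLineDerivOp {ι : Type*} [Fintype ι]
    (b : OrthonormalBasis ι ℝ V) (m : ℕ) (f g : 𝓢(V, ℂ)) :
    ∑ I : Fin m → ι, ∫ x, inner ℝ ((∂^{b ∘ I} f : 𝓢(V, ℂ)) x) ((∂^{b ∘ I} g : 𝓢(V, ℂ)) x) =
      (2 * Real.pi) ^ (2 * m) * ∫ ξ, ‖ξ‖ ^ (2 * m) * (inner ℂ (𝓕 f ξ) (𝓕 g ξ)).re := by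
  have h1 : ∀ f g : 𝓢(V, ℂ), ∫ x, inner ℝ (f x) (g x) = ∫ ξ, (inner ℂ (𝓕 f ξ) (𝓕 g ξ)).re := by
    intro f g
    have h2 := congrArg Complex.re (integral_inner_fourier_fourier f g)
    rw [← RCLike.re_eq_complex_re, ← integral_re (integrable_inner _ _),
      ← integral_re (integrable_inner _ _)] at h2
    exact h2.symm
  simp_rw [h1]
  have h3 : ∀ I : Fin m → ι, Integrable fun ξ ↦
      (inner ℂ (𝓕 (∂^{b ∘ I} f : 𝓢(V, ℂ)) ξ) (𝓕 (∂^{b ∘ I} g : 𝓢(V, ℂ)) ξ)).re :=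
    fun I ↦ (integrable_inner _ _).re
  rw [← integral_finsetSum _ fun I _ ↦ h3 I, ← integral_const_mul]
  congr 1 with ξ
  rw [← Complex.re_sum, sum_inner_fourier_iteratedLineDerivOp, Complex.re_ofReal_mul, mul_assoc]

end Plancherel

section TemperateInv

theorem Function.HasTemperateGrowth.inv_of_le {E : Type*} [NormedAddCommGroup E] [NormedSpace ℝ E]
    {f : E → ℝ} (hf : f.HasTemperateGrowth) {ε : ℝ} (hε : 0 < ε) (h : ∀ x, ε ≤ f x) :
    (fun x ↦ (f x)⁻¹).HasTemperateGrowth := by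
  set t := Set.Ioi (ε / 2)
  have ht : Set.range f ⊆ t := by
    rintro - ⟨y, rfl⟩
    exact lt_of_lt_of_le (by linarith) (h y)
  have ht0 : ∀ x ∈ t, x ≠ 0 := fun x hx ↦ ((half_pos hε).trans hx).ne'
  have hdiff : ContDiffOn ℝ (⊤ : ℕ∞) (fun x : ℝ ↦ x⁻¹) t := contDiffOn_fun_id.inv ht0
  have hunique : UniqueDiffOn ℝ t := isOpen_Ioi.uniqueDiffOn
  refine HasTemperateGrowth.comp' ht hunique hdiff (fun N ↦ ?_) hf
  refine ⟨0, N.factorial * (max 1 (ε / 2)⁻¹) ^ (N + 1), by positivity, fun n hn x hx ↦ ?_⟩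
  rw [norm_iteratedFDerivWithin_eq_norm_iteratedDerivWithin,
    iteratedDerivWithin_eq_iteratedDeriv hunique (contDiffAt_inv ℝ (ht0 x hx)) hx,
    iteratedDeriv_eq_iterate, iter_deriv_inv, pow_zero, mul_one, norm_mul, norm_mul]
  have hx0 : 0 < x := (half_pos hε).trans hx
  have h1 : ‖x ^ (-1 - n : ℤ)‖ ≤ (max 1 (ε / 2)⁻¹) ^ (N + 1) := by
    have h2 : (-1 - n : ℤ) = -((n + 1 : ℕ) : ℤ) := by push_cast; ring
    rw [h2, zpow_neg, zpow_natCast, ← inv_pow, norm_pow, Real.norm_of_nonneg (by positivity)]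
    calc x⁻¹ ^ (n + 1) ≤ (max 1 (ε / 2)⁻¹) ^ (n + 1) := by
          gcongr
          exact le_max_of_le_right (inv_anti₀ (half_pos hε) (le_of_lt hx))
      _ ≤ _ := pow_le_pow_right₀ (le_max_left _ _) (by omega)
  have h3 : ‖((-1 : ℝ)) ^ n‖ * ‖(n.factorial : ℝ)‖ ≤ N.factorial := by
    simp only [norm_pow, norm_neg, norm_one, one_pow, one_mul, Real.norm_natCast]
    exact_mod_cast Nat.factorial_le hn
  gcongr

end TemperateInv

section Regularised

/-- The fractional weight, regularised at low frequencies. -/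
def regularisedWeight {V : Type*} [NormedAddCommGroup V] (k : ℕ) (ε l : ℝ) (ξ : V) : ℝ :=
  ε + ‖ξ‖ ^ (2 * k) + l * ‖ξ‖ ^ (2 * (k + 1))

theorem le_regularisedWeight {V : Type*} [NormedAddCommGroup V] (k : ℕ) (ε : ℝ) {l : ℝ} (hl : 0 ≤ l) (ξ : V) :
    ε ≤ regularisedWeight k ε l ξ := by
  unfold regularisedWeight
  have : 0 ≤ ‖ξ‖ ^ (2 * k) := by positivity
  have : 0 ≤ l * ‖ξ‖ ^ (2 * (k + 1)) := by positivity
  linarith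

theorem continuous_regularisedWeight {V : Type*} [NormedAddCommGroup V] (k : ℕ) (ε l : ℝ) :
    Continuous (regularisedWeight k ε l : V → ℝ) := by
  unfold regularisedWeight
  fun_prop

variable {V : Type*} [NormedAddCommGroup V] [InnerProductSpace ℝ V]

theorem hasTemperateGrowth_inv_regularisedWeight (k : ℕ) {ε l : ℝ} (hε : 0 < ε) (hl : 0 ≤ l) :
    (fun ξ : V ↦ (regularisedWeight k ε l ξ)⁻¹).HasTemperateGrowth := by
  refine Function.HasTemperateGrowth.inv_of_le ?_ hε (le_regularisedWeight k ε hl)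
  unfold regularisedWeight
  simp_rw [pow_mul]
  fun_prop

/-- The Schwartz function `⟨v, u⟩ μ`. -/
def SchwartzMap.component (u : 𝓢(V, V)) (μ : 𝓢(V, ℂ)) (v : V) : 𝓢(V, ℂ) :=
  bilinLeftCLM ((ContinuousLinearMap.lsmul ℝ ℝ : ℝ →L[ℝ] ℂ →L[ℝ] ℂ).flip.bilinearComp
    (ContinuousLinearMap.id ℝ ℂ) (innerSL ℝ v)) u.hasTemperateGrowth μ

@[simp]
theorem SchwartzMap.component_apply (u : 𝓢(V, V)) (μ : 𝓢(V, ℂ)) (v x : V) :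
    component u μ v x = (inner ℝ v (u x) : ℝ) * μ x := by
  rw [← Complex.real_smul]
  rfl

variable [FiniteDimensional ℝ V] [MeasurableSpace V] [BorelSpace V]

/-- The Fourier side density of the transport pairing. -/
def SchwartzMap.transportSymbol {ι : Type*} [Fintype ι] (b : OrthonormalBasis ι ℝ V)
    (u : 𝓢(V, V)) (μ : 𝓢(V, ℂ)) (ξ : V) : ℂ :=
  ∑ i, inner ℂ (𝓕 (component u μ (b i)) ξ) (𝓕 (∂_{b i} μ : 𝓢(V, ℂ)) ξ)

/-- The Schwartz function with Fourier transform `𝓕 μ / regularisedWeight`. -/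
def SchwartzMap.regularisedPotential (k : ℕ) (ε l : ℝ) (μ : 𝓢(V, ℂ)) : 𝓢(V, ℂ) :=
  𝓕⁻ (smulLeftCLM ℂ (fun ξ : V ↦ (regularisedWeight k ε l ξ)⁻¹) (𝓕 μ))

theorem SchwartzMap.fourier_regularisedPotential (k : ℕ) {ε l : ℝ} (hε : 0 < ε) (hl : 0 ≤ l)
    (μ : 𝓢(V, ℂ)) (ξ : V) : 𝓕 (regularisedPotential k ε l μ) ξ =
      ((regularisedWeight k ε l ξ)⁻¹ : ℝ) * 𝓕 μ ξ := by
  rw [regularisedPotential, FourierTransform.fourier_fourierInv_eq,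
    smulLeftCLM_apply_apply (hasTemperateGrowth_inv_regularisedWeight k hε hl), Complex.real_smul]

theorem SchwartzMap.integral_inner_fourier_transport {ι : Type*} [Fintype ι]
    (b : OrthonormalBasis ι ℝ V) (k : ℕ) {ε l : ℝ} (hε : 0 < ε) (hl : 0 ≤ l)
    (u : 𝓢(V, V)) (μ : 𝓢(V, ℂ)) :
    ∫ ξ, inner ℂ (𝓕 μ ξ) (𝓕 (transport u (regularisedPotential k ε l μ)) ξ) =
      ∫ ξ, ((regularisedWeight k ε l ξ)⁻¹ : ℝ) * transportSymbol b u μ ξ := by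
  set h := regularisedPotential k ε l μ with hh
  rw [integral_inner_fourier_fourier]
  calc ∫ x, inner ℂ (μ x) (transport u h x)
      = ∫ x, ∑ i, inner ℂ (component u μ (b i) x) ((∂_{b i} h : 𝓢(V, ℂ)) x) := by
        congr 1 with x
        rw [transport_apply]
        conv_lhs => rw [← b.sum_repr' (u x)]
        rw [map_sum, inner_sum]
        refine Finset.sum_congr rfl fun i _ ↦ ?_
        rw [map_smul, lineDerivOp_apply_eq_fderiv]
        simp only [component_apply, RCLike.inner_apply, map_mul, Complex.conj_ofReal,
          Complex.real_smul]
        ring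
    _ = ∑ i, ∫ ξ, inner ℂ (𝓕 (component u μ (b i)) ξ) (𝓕 (∂_{b i} h : 𝓢(V, ℂ)) ξ) := by
        rw [integral_finsetSum _ fun i _ ↦ integrable_inner _ _]
        simp_rw [integral_inner_fourier_fourier]
    _ = ∫ ξ, ∑ i, inner ℂ (𝓕 (component u μ (b i)) ξ) (𝓕 (∂_{b i} h : 𝓢(V, ℂ)) ξ) :=
        (integral_finsetSum _ fun i _ ↦ integrable_inner _ _).symm
    _ = _ := by
        congr 1 with ξ
        rw [transportSymbol, Finset.mul_sum]
        refine Finset.sum_congr rfl fun i _ ↦ ?_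
        rw [fourier_lineDerivOp_apply, fourier_lineDerivOp_apply, hh,
          fourier_regularisedPotential k hε hl]
        simp only [RCLike.inner_apply]
        ring

theorem SchwartzMap.continuous_transportSymbol {ι : Type*} [Fintype ι]
    (b : OrthonormalBasis ι ℝ V) (u : 𝓢(V, V)) (μ : 𝓢(V, ℂ)) :
    Continuous (transportSymbol b u μ) :=
  continuous_finsetSum _ fun i _ ↦
    (𝓕 (component u μ (b i))).continuous.inner (𝓕 (∂_{b i} μ : 𝓢(V, ℂ))).continuous

theorem SchwartzMap.integrable_transportSymbol {ι : Type*} [Fintype ι]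
    (b : OrthonormalBasis ι ℝ V) (u : 𝓢(V, V)) (μ : 𝓢(V, ℂ)) :
    Integrable (transportSymbol b u μ) :=
  integrable_finsetSum _ fun _ _ ↦ integrable_inner _ _

theorem SchwartzMap.integrable_inv_regularisedWeight_mul_transportSymbol {ι : Type*} [Fintype ι]
    (b : OrthonormalBasis ι ℝ V) (k : ℕ) {ε l : ℝ} (hε : 0 < ε) (hl : 0 ≤ l)
    (u : 𝓢(V, V)) (μ : 𝓢(V, ℂ)) :
    Integrable fun ξ ↦ (((regularisedWeight k ε l ξ)⁻¹ : ℝ) : ℂ) * transportSymbol b u μ ξ := by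
  have hP : ∀ ξ : V, 0 < regularisedWeight k ε l ξ := fun ξ ↦
    hε.trans_le (le_regularisedWeight k ε hl ξ)
  refine ((integrable_transportSymbol b u μ).norm.const_mul ε⁻¹).mono' ?_
    (Eventually.of_forall fun ξ ↦ ?_)
  · exact ((Complex.continuous_ofReal.comp ((continuous_regularisedWeight k ε l).inv₀
      fun ξ ↦ (hP ξ).ne')).mul (continuous_transportSymbol b u μ)).aestronglyMeasurable
  · rw [norm_mul, Complex.norm_real, Real.norm_of_nonneg (inv_nonneg.2 (hP ξ).le)]
    gcongr
    exact le_regularisedWeight k ε hl ξ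

theorem SchwartzMap.integrable_norm_pow_mul_re_inner (n : ℕ) (f g : 𝓢(V, ℂ)) :
    Integrable (fun ξ ↦ ‖ξ‖ ^ n * (inner ℂ (f ξ) (g ξ)).re) := by
  obtain ⟨C, hC⟩ := f.decay 0 0
  have hC' : ∀ x, ‖f x‖ ≤ C := fun x ↦ by simpa using hC.2 x
  have h1 : Integrable fun ξ ↦ C * (‖ξ‖ ^ n * ‖g ξ‖) :=
    (g.integrable_pow_mul volume n).const_mul C
  refine h1.mono' ?_ (Eventually.of_forall fun ξ ↦ ?_)
  · exact ((continuous_norm.pow n).mul (Complex.continuous_re.comp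
      (f.continuous.inner g.continuous))).aestronglyMeasurable
  · rw [norm_mul, norm_pow, norm_norm]
    calc ‖ξ‖ ^ n * ‖(inner ℂ (f ξ) (g ξ)).re‖ ≤ ‖ξ‖ ^ n * (C * ‖g ξ‖) := by
          gcongr
          refine (Complex.abs_re_le_norm _).trans ((norm_inner_le_norm _ _).trans ?_)
          gcongr
          exact hC' ξ
      _ = _ := by ring

theorem SchwartzMap.exists_integral_transportSymbol_regularised_le (k : ℕ) (hk : 0 < k)
    (hkd : 2 * k < Module.finrank ℝ V) {ι : Type*} [Fintype ι] (b : OrthonormalBasis ι ℝ V) :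
    ∃ C : ℝ, 0 ≤ C ∧ ∀ (u : 𝓢(V, V)) (μ : 𝓢(V, ℂ)) (M : ℝ), (∀ x, ‖fderiv ℝ u x‖ ≤ M) →
      ∀ ε l : ℝ, 0 < ε → 0 ≤ l →
      ∫ ξ, (transportSymbol b u μ ξ).re * (regularisedWeight k ε l ξ)⁻¹ ≤
      C * (M + (eLpNorm (iteratedFDeriv ℝ (k + 1) u)
        ((Module.finrank ℝ V : ℝ≥0) / k : ℝ≥0) volume).toReal) *
        ∫ ξ, ‖𝓕 μ ξ‖ ^ 2 * (regularisedWeight k ε l ξ)⁻¹ := by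
  obtain ⟨C₀, hC₀, h₀⟩ := exists_abs_sum_integral_inner_transport_le k 0 hk hkd (by omega) b
  obtain ⟨C₁, hC₁, h₁⟩ := exists_abs_sum_integral_inner_transport_le k k hk hkd (by omega) b
  obtain ⟨C₂, hC₂, h₂⟩ := exists_abs_sum_integral_inner_transport_le k (k + 1) hk hkd le_rfl b
  refine ⟨C₀ + C₁ + C₂, by positivity, fun u μ M hM ε l hε hl ↦ ?_⟩
  set N := M + (eLpNorm (iteratedFDeriv ℝ (k + 1) u)
        ((Module.finrank ℝ V : ℝ≥0) / k : ℝ≥0) volume).toReal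
  have hN : 0 ≤ N := add_nonneg ((norm_nonneg _).trans (hM 0)) ENNReal.toReal_nonneg
  set h := regularisedPotential k ε l μ with hh
  set w := transport u h with hw
  let X (m : ℕ) : ℝ := ∫ ξ, ‖ξ‖ ^ (2 * m) * (inner ℂ (𝓕 h ξ) (𝓕 w ξ)).re
  let Y (m : ℕ) : ℝ := ∫ ξ, ‖ξ‖ ^ (2 * m) * (inner ℂ (𝓕 h ξ) (𝓕 h ξ)).re
  have hY : ∀ m, 0 ≤ Y m := fun m ↦ integral_nonneg fun ξ ↦ by
    have : 0 ≤ (inner ℂ (𝓕 h ξ) (𝓕 h ξ)).re :=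
      inner_self_nonneg (𝕜 := ℂ) (x := 𝓕 h ξ)
    positivity
  have key : ∀ (m : ℕ) (C : ℝ), 0 ≤ C → C ≤ C₀ + C₁ + C₂ →
      (|∑ I : Fin m → ι, ∫ x, inner ℝ ((∂^{b ∘ I} h : 𝓢(V, ℂ)) x)
        ((∂^{b ∘ I} (transport u h) : 𝓢(V, ℂ)) x)| ≤
      C * N * ∑ I : Fin m → ι, ∫ x, ‖(∂^{b ∘ I} h : 𝓢(V, ℂ)) x‖ ^ 2) →
      X m ≤ (C₀ + C₁ + C₂) * N * Y m := by
    intro m C hC hCle hm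
    simp_rw [← real_inner_self_eq_norm_sq] at hm
    rw [sum_integral_inner_iteratedLineDerivOp, sum_integral_inner_iteratedLineDerivOp] at hm
    have hpi : 0 < (2 * Real.pi) ^ (2 * m) := by positivity
    have h3 : (2 * Real.pi) ^ (2 * m) * X m ≤ (2 * Real.pi) ^ (2 * m) * (C * N * Y m) :=
      (le_abs_self _).trans (hm.trans_eq (by ring))
    refine (le_of_mul_le_mul_left h3 hpi).trans ?_
    gcongr
    exact hY m
  have k₀ := key 0 C₀ hC₀ (by linarith) (h₀ u h M hM)
  have k₁ := key k C₁ hC₁ (by linarith) (h₁ u h M hM)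
  have k₂ := key (k + 1) C₂ hC₂ (by linarith) (h₂ u h M hM)
  have hsplit : ∀ g : 𝓢(V, ℂ), ∫ ξ, (inner ℂ (𝓕 μ ξ) (𝓕 g ξ)).re =
      ε * (∫ ξ, ‖ξ‖ ^ (2 * 0) * (inner ℂ (𝓕 h ξ) (𝓕 g ξ)).re) +
      (∫ ξ, ‖ξ‖ ^ (2 * k) * (inner ℂ (𝓕 h ξ) (𝓕 g ξ)).re) +
      l * (∫ ξ, ‖ξ‖ ^ (2 * (k + 1)) * (inner ℂ (𝓕 h ξ) (𝓕 g ξ)).re) := by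
    intro g
    have hi := fun n ↦ integrable_norm_pow_mul_re_inner n (𝓕 h) (𝓕 g)
    have hi2 : Integrable fun ξ ↦ ε * (‖ξ‖ ^ (2 * 0) * (inner ℂ (𝓕 h ξ) (𝓕 g ξ)).re) +
        ‖ξ‖ ^ (2 * k) * (inner ℂ (𝓕 h ξ) (𝓕 g ξ)).re := ((hi _).const_mul _).add (hi _)
    rw [← integral_const_mul, ← integral_const_mul, ← integral_add ((hi _).const_mul _) (hi _),
      ← integral_add hi2 ((hi _).const_mul _)]
    congr 1 with ξ
    have hP : 0 < regularisedWeight k ε l ξ := hε.trans_le (le_regularisedWeight k ε hl ξ)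
    have h4 : 𝓕 μ ξ = (regularisedWeight k ε l ξ : ℝ) * 𝓕 h ξ := by
      rw [hh, fourier_regularisedPotential k hε hl, ← mul_assoc, ← Complex.ofReal_mul,
        mul_inv_cancel₀ hP.ne', Complex.ofReal_one, one_mul]
    rw [h4, regularisedWeight]
    simp only [RCLike.inner_apply, map_mul, Complex.conj_ofReal]
    rw [mul_left_comm, Complex.re_ofReal_mul]
    ring
  have hL : ∫ ξ, (transportSymbol b u μ ξ).re * (regularisedWeight k ε l ξ)⁻¹ =
      ∫ ξ, (inner ℂ (𝓕 μ ξ) (𝓕 w ξ)).re := by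
    have h5 := congrArg Complex.re (integral_inner_fourier_transport b k hε hl u μ)
    rw [← RCLike.re_eq_complex_re, ← integral_re (integrable_inner _ _), ← integral_re
      (integrable_inv_regularisedWeight_mul_transportSymbol b k hε hl u μ)] at h5
    refine Eq.trans ?_ h5.symm
    congr 1 with ξ
    rw [RCLike.re_eq_complex_re, Complex.re_ofReal_mul, mul_comm]
  have hR : ∫ ξ, ‖𝓕 μ ξ‖ ^ 2 * (regularisedWeight k ε l ξ)⁻¹ =
      ∫ ξ, (inner ℂ (𝓕 μ ξ) (𝓕 h ξ)).re := by
    congr 1 with ξ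
    rw [hh, fourier_regularisedPotential k hε hl, RCLike.inner_apply, mul_assoc, Complex.mul_conj,
      Complex.re_ofReal_mul, Complex.ofReal_re, Complex.normSq_eq_norm_sq, mul_comm]
  rw [hL, hR, hsplit, hsplit]
  calc _ ≤ ε * ((C₀ + C₁ + C₂) * N * Y 0) + (C₀ + C₁ + C₂) * N * Y k +
        l * ((C₀ + C₁ + C₂) * N * Y (k + 1)) := by gcongr
    _ = _ := by ring

end Regularised

section Mixture

variable {B Ω E : Type*} [MeasurableSpace B] [MeasurableSpace Ω] [NormedAddCommGroup E]
  [NormedSpace ℝ E] {ν : Measure B} {P : Measure Ω} [SFinite ν] [SFinite P]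
  {κ : B → Ω → ℝ} {Φ : Ω → ℝ} {H : Ω → E}

theorem integrable_mixture (hκ : AEStronglyMeasurable (Function.uncurry κ) (ν.prod P))
    (hκ0 : ∀ᵐ b ∂ν, ∀ w, 0 ≤ κ b w) (hInt : ∀ᵐ w ∂P, Integrable (κ · w) ν)
    (hΦ : ∀ᵐ w ∂P, ∫ b, κ b w ∂ν = Φ w) (hH : AEStronglyMeasurable H P)
    (hΦH : Integrable (fun w ↦ Φ w * ‖H w‖) P) :
    Integrable (fun z : B × Ω ↦ κ z.1 z.2 • H z.2) (ν.prod P) := by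
  have hmeas : AEStronglyMeasurable (fun z : B × Ω ↦ κ z.1 z.2 • H z.2) (ν.prod P) :=
    hκ.smul hH.comp_snd
  rw [integrable_prod_iff' hmeas]
  refine ⟨hInt.mono fun w h ↦ h.smul_const (H w), hΦH.congr ?_⟩
  filter_upwards [hΦ] with w h
  rw [← h, ← integral_mul_const]
  refine integral_congr_ae (hκ0.mono fun b hb ↦ ?_)
  simp only [norm_smul, Real.norm_of_nonneg (hb w)]

theorem integral_mixture [CompleteSpace E] (hκ : AEStronglyMeasurable (Function.uncurry κ) (ν.prod P))
    (hκ0 : ∀ᵐ b ∂ν, ∀ w, 0 ≤ κ b w) (hInt : ∀ᵐ w ∂P, Integrable (κ · w) ν)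
    (hΦ : ∀ᵐ w ∂P, ∫ b, κ b w ∂ν = Φ w) (hH : AEStronglyMeasurable H P)
    (hΦH : Integrable (fun w ↦ Φ w * ‖H w‖) P) :
    ∫ b, ∫ w, κ b w • H w ∂P ∂ν = ∫ w, Φ w • H w ∂P := by
  rw [integral_integral_swap (integrable_mixture hκ hκ0 hInt hΦ hH hΦH)]
  refine integral_congr_ae ?_
  filter_upwards [hΦ] with w h
  rw [integral_smul_const, h]

end Mixture

section RieszKernel

variable {V : Type*} [NormedAddCommGroup V] [InnerProductSpace ℝ V]
  [FiniteDimensional ℝ V] [MeasurableSpace V] [BorelSpace V]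

theorem integrableOn_norm_rpow_neg_ball [Nontrivial V] {β : ℝ} (hβ : β < Module.finrank ℝ V) :
    IntegrableOn (fun x : V ↦ ‖x‖ ^ (-β)) (Metric.ball 0 1) := by
  have h := (integrable_fun_norm_addHaar (volume : Measure V)
    (f := (Set.Iio (1 : ℝ)).indicator fun y ↦ y ^ (-β))).1
  have h2 : (fun x : V ↦ (Set.Iio (1 : ℝ)).indicator (fun y ↦ y ^ (-β)) ‖x‖) =
      (Metric.ball (0 : V) 1).indicator fun x ↦ ‖x‖ ^ (-β) := by
    ext x
    by_cases hx : ‖x‖ < 1 <;> simp [Set.indicator, hx]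
  rw [← integrable_indicator_iff Metric.isOpen_ball.measurableSet, ← h2]
  refine (integrable_fun_norm_addHaar (volume : Measure V)).2 ?_
  have hd : 0 < Module.finrank ℝ V := Module.finrank_pos
  have h3 : IntegrableOn (fun y : ℝ ↦ y ^ ((Module.finrank ℝ V : ℝ) - 1 - β)) (Set.Ioo 0 1) :=
    (intervalIntegral.integrableOn_Ioo_rpow_iff one_pos).2 (by linarith)
  have h4 := (integrable_indicator_iff measurableSet_Ioo).2 h3
  refine IntegrableOn.congr_fun h4.integrableOn (fun y hy ↦ ?_) measurableSet_Ioi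
  have hy0 : 0 < y := hy
  by_cases h1 : y < 1
  · simp only [Set.indicator, Set.mem_Ioo, hy0, h1, and_self, if_true, Set.mem_Iio, smul_eq_mul]
    rw [← Real.rpow_natCast, ← Real.rpow_add hy0, Nat.cast_sub hd]
    norm_num [sub_eq_add_neg]
  · simp [Set.indicator, h1]

/-- A bounded integrable function has a bounded Riesz potential. -/
theorem exists_integrable_norm_mul_rpow [Nontrivial V] {E : Type*} [NormedAddCommGroup E]
    {β : ℝ} (hβ0 : 0 ≤ β) (hβ : β < Module.finrank ℝ V) {g : V → E} (hg : Integrable g) {B : ℝ}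
    (hB : ∀ x, ‖g x‖ ≤ B) : ∃ A : ℝ, ∀ x, Integrable (fun y ↦ ‖x - y‖ ^ (-β) * ‖g y‖) ∧
      ∫ y, ‖x - y‖ ^ (-β) * ‖g y‖ ≤ A := by
  set q : V → ℝ := (Metric.ball (0 : V) 1).indicator fun x ↦ ‖x‖ ^ (-β) with hq
  have hqi : Integrable q := (integrable_indicator_iff Metric.isOpen_ball.measurableSet).2
    (integrableOn_norm_rpow_neg_ball hβ)
  have hq0 : ∀ z, 0 ≤ q z := fun z ↦ Set.indicator_nonneg (fun _ _ ↦ by positivity) _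
  have hle : ∀ x y, ‖x - y‖ ^ (-β) * ‖g y‖ ≤ B * q (x - y) + ‖g y‖ := fun x y ↦ by
    by_cases h : x - y ∈ Metric.ball (0 : V) 1
    · rw [hq, Set.indicator_of_mem h]
      have h1 : 0 ≤ ‖x - y‖ ^ (-β) := by positivity
      nlinarith [hB y, norm_nonneg (g y)]
    · rw [hq, Set.indicator_of_notMem h]
      have : ‖x - y‖ ^ (-β) ≤ 1 :=
        Real.rpow_le_one_of_one_le_of_nonpos (by simpa using h) (by linarith)
      nlinarith [norm_nonneg (g y)]
  have hi : ∀ x, Integrable fun y ↦ B * q (x - y) + ‖g y‖ := fun x ↦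
    ((hqi.comp_sub_left x).const_mul B).add hg.norm
  have hm : ∀ x, Integrable fun y ↦ ‖x - y‖ ^ (-β) * ‖g y‖ := fun x ↦ by
    refine (hi x).mono' ?_ (Eventually.of_forall fun y ↦ ?_)
    · exact (by fun_prop : Measurable fun y : V ↦ ‖x - y‖ ^ (-β)).aestronglyMeasurable.mul
        hg.norm.aestronglyMeasurable
    · rw [Real.norm_of_nonneg (by positivity)]
      exact hle x y
  refine ⟨B * (∫ z, q z) + ∫ y, ‖g y‖, fun x ↦ ⟨hm x, ?_⟩⟩
  calc _ ≤ ∫ y, (B * q (x - y) + ‖g y‖) := integral_mono (hm x) (hi x) (hle x)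
    _ = _ := by
      rw [integral_add ((hqi.comp_sub_left x).const_mul B) hg.norm, integral_const_mul,
        integral_sub_left_eq_self q]

theorem integrable_rpow_mul_norm [Nontrivial V] {E : Type*} [NormedAddCommGroup E]
    {β : ℝ} (hβ0 : 0 ≤ β) (hβ : β < Module.finrank ℝ V) {g : V → E} (hg : Integrable g) {B : ℝ}
    (hB : ∀ x, ‖g x‖ ≤ B) : Integrable fun y ↦ ‖y‖ ^ (-β) * ‖g y‖ := by
  obtain ⟨A, hA⟩ := exists_integrable_norm_mul_rpow hβ0 hβ hg hB
  simpa using (hA 0).1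

theorem integrable_prod_rpow_mul_norm_mul_norm [Nontrivial V] {E F : Type*} [NormedAddCommGroup E]
    [NormedAddCommGroup F]
    {β : ℝ} (hβ0 : 0 ≤ β) (hβ : β < Module.finrank ℝ V) {f : V → F} (hf : Integrable f)
    {g : V → E} (hg : Integrable g) {B : ℝ} (hB : ∀ x, ‖g x‖ ≤ B) :
    Integrable fun z : V × V ↦ ‖z.1 - z.2‖ ^ (-β) * (‖f z.1‖ * ‖g z.2‖) := by
  obtain ⟨A, hA⟩ := exists_integrable_norm_mul_rpow hβ0 hβ hg hB
  have hmeas : AEStronglyMeasurable (fun z : V × V ↦ ‖z.1 - z.2‖ ^ (-β) * (‖f z.1‖ * ‖g z.2‖)) :=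
    (by fun_prop : Measurable fun z : V × V ↦ ‖z.1 - z.2‖ ^ (-β)).aestronglyMeasurable.mul
      (hf.norm.aestronglyMeasurable.comp_fst.mul hg.norm.aestronglyMeasurable.comp_snd)
  have hcomm : ∀ x y, ‖x - y‖ ^ (-β) * (‖f x‖ * ‖g y‖) = ‖f x‖ * (‖x - y‖ ^ (-β) * ‖g y‖) :=
    fun x y ↦ by ring
  rw [Measure.volume_eq_prod] at hmeas ⊢
  rw [integrable_prod_iff hmeas]
  have hnn : ∀ x y, 0 ≤ ‖x - y‖ ^ (-β) * ‖g y‖ := fun x y ↦ by positivity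
  simp only [hcomm, norm_mul, norm_norm, Real.norm_of_nonneg (Real.rpow_nonneg (norm_nonneg _) _)]
  simp only [integral_const_mul]
  refine ⟨Eventually.of_forall fun x ↦ (hA x).1.const_mul _, (hf.norm.mul_const A).mono' ?_ ?_⟩
  · have := hmeas.norm.integral_prod_right'
    simpa only [hcomm, norm_mul, norm_norm, integral_const_mul,
      Real.norm_of_nonneg (Real.rpow_nonneg (norm_nonneg _) _)] using this
  · refine Eventually.of_forall fun x ↦ ?_
    rw [Real.norm_of_nonneg (mul_nonneg (norm_nonneg _) (integral_nonneg (hnn x)))]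
    gcongr
    exact (hA x).2

end RieszKernel

section Fractional

theorem inv_regularisedWeight_le {V : Type*} [NormedAddCommGroup V] (k : ℕ) {ε l : ℝ}
    (hε : 0 ≤ ε) (hl : 0 ≤ l) {ξ : V} (hξ : ξ ≠ 0) :
    (regularisedWeight k ε l ξ)⁻¹ ≤ ‖ξ‖ ^ (-(2 * k : ℝ)) := by
  have h0 : 0 < ‖ξ‖ := norm_pos_iff.2 hξ
  rw [Real.rpow_neg h0.le]
  have h1 : ‖ξ‖ ^ (2 * k : ℝ) = ‖ξ‖ ^ (2 * k) := by exact_mod_cast Real.rpow_natCast ‖ξ‖ (2 * k)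
  rw [h1]
  gcongr
  unfold regularisedWeight
  have : 0 ≤ l * ‖ξ‖ ^ (2 * (k + 1)) := by positivity
  linarith

theorem regularisedWeight_nonneg {V : Type*} [NormedAddCommGroup V] (k : ℕ) {ε l : ℝ}
    (hε : 0 ≤ ε) (hl : 0 ≤ l) (ξ : V) : 0 ≤ regularisedWeight k ε l ξ :=
  hε.trans (le_regularisedWeight k ε hl ξ)

theorem rpow_mul_inv_regularisedWeight {V : Type*} [NormedAddCommGroup V] (k : ℕ) {a l : ℝ}
    (ha : a ∈ Set.Ioo (0 : ℝ) 1) (hl : 0 < l) {ξ : V} (hξ : ξ ≠ 0) :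
    l ^ (a - 1) * (regularisedWeight k 0 l ξ)⁻¹ =
      ‖ξ‖ ^ (-(2 * k : ℝ)) * Real.rpowIntegrand₀₁ a l (‖ξ‖ ^ (-2 : ℝ)) := by
  have h0 : 0 < ‖ξ‖ := norm_pos_iff.2 hξ
  rw [Real.rpowIntegrand₀₁_eq_pow_div ha hl.le (by positivity), Real.rpow_neg h0.le,
    Real.rpow_neg h0.le]
  have h1 : ‖ξ‖ ^ (2 * k : ℝ) = ‖ξ‖ ^ (2 * k) := by exact_mod_cast Real.rpow_natCast ‖ξ‖ (2 * k)
  have h2 : ‖ξ‖ ^ (2 : ℝ) = ‖ξ‖ ^ 2 := by exact_mod_cast Real.rpow_natCast ‖ξ‖ 2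
  rw [h1, h2, regularisedWeight, mul_add, pow_add]
  have : l * ‖ξ‖ ^ 2 + 1 ≠ 0 := by positivity
  field_simp
  ring

theorem measurable_regularisedWeight {V : Type*} [NormedAddCommGroup V] [MeasurableSpace V]
    [BorelSpace V] (k : ℕ) : Measurable fun z : (ℝ × ℝ) × V ↦
    regularisedWeight k z.1.1 z.1.2 z.2 := by
  unfold regularisedWeight
  fun_prop

variable {V : Type*} [NormedAddCommGroup V] [InnerProductSpace ℝ V]
  [FiniteDimensional ℝ V] [MeasurableSpace V] [BorelSpace V]

theorem tendsto_integral_mul_inv_regularisedWeight [Nontrivial V] (k : ℕ) {l : ℝ} (hl : 0 ≤ l)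
    {H : V → ℝ} (hH : AEStronglyMeasurable H)
    (hi : Integrable fun ξ ↦ ‖ξ‖ ^ (-(2 * k : ℝ)) * ‖H ξ‖) :
    Tendsto (fun ε : ℝ ↦ ∫ ξ, H ξ * (regularisedWeight k ε l ξ)⁻¹) (𝓝[>] 0)
      (𝓝 (∫ ξ, H ξ * (regularisedWeight k 0 l ξ)⁻¹)) := by
  have hne : ∀ᵐ ξ : V, ξ ≠ 0 := by simp [ae_iff]
  refine tendsto_integral_filter_of_dominated_convergence _ ?_ ?_ hi ?_
  · exact Eventually.of_forall fun ε ↦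
      hH.mul (continuous_regularisedWeight k ε l).measurable.inv.aestronglyMeasurable
  · filter_upwards [self_mem_nhdsWithin] with ε hε
    filter_upwards [hne] with ξ hξ
    rw [norm_mul, mul_comm, norm_inv,
      Real.norm_of_nonneg (regularisedWeight_nonneg k (le_of_lt hε) hl ξ)]
    gcongr
    exact inv_regularisedWeight_le k (le_of_lt hε) hl hξ
  · filter_upwards [hne] with ξ hξ
    refine Tendsto.const_mul _ (Tendsto.inv₀ ?_ ?_)
    · refine Tendsto.mono_left (Continuous.tendsto ?_ 0) nhdsWithin_le_nhds
      unfold regularisedWeight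
      fun_prop
    · have h0 : 0 < ‖ξ‖ := norm_pos_iff.2 hξ
      unfold regularisedWeight
      positivity

/-- The fractional weight is an average of the weights `‖ξ‖ ^ (2k) + l ‖ξ‖ ^ (2k+2)`. -/
theorem integral_rpow_mul_integral_inv_regularisedWeight [Nontrivial V] (k : ℕ) {a : ℝ}
    (ha : a ∈ Set.Ioo (0 : ℝ) 1) {H : V → ℝ} (hH : AEStronglyMeasurable H)
    (hi : Integrable fun ξ ↦ ‖ξ‖ ^ (-(2 * (k + a))) * ‖H ξ‖) :
    Integrable (fun l : ℝ ↦ l ^ (a - 1) * ∫ ξ, H ξ * (regularisedWeight k 0 l ξ)⁻¹)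
      (volume.restrict (Set.Ioi 0)) ∧
    ∫ l in Set.Ioi (0 : ℝ), l ^ (a - 1) * ∫ ξ, H ξ * (regularisedWeight k 0 l ξ)⁻¹ =
      (∫ t in Set.Ioi 0, Real.rpowIntegrand₀₁ a t 1) * ∫ ξ, ‖ξ‖ ^ (-(2 * (k + a))) * H ξ := by
  set c := ∫ t in Set.Ioi 0, Real.rpowIntegrand₀₁ a t 1 with hc
  have hne : ∀ᵐ ξ : V, ξ ≠ 0 := by simp [ae_iff]
  set κ : ℝ → V → ℝ := fun l ξ ↦ l ^ (a - 1) * (regularisedWeight k 0 l ξ)⁻¹ with hκdef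
  have hκ : AEStronglyMeasurable (Function.uncurry κ)
      ((volume.restrict (Set.Ioi (0 : ℝ))).prod (volume : Measure V)) := by
    refine Measurable.aestronglyMeasurable (Measurable.mul (by fun_prop) (Measurable.inv ?_))
    exact (measurable_regularisedWeight k).comp
      (by fun_prop : Measurable fun z : ℝ × V ↦ (((0 : ℝ), z.1), z.2))
  have hκ0 : ∀ᵐ l ∂volume.restrict (Set.Ioi (0 : ℝ)), ∀ ξ : V, 0 ≤ κ l ξ := by
    filter_upwards [ae_restrict_mem measurableSet_Ioi] with l hl ξ
    have hl0 : 0 < l := hl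
    have := regularisedWeight_nonneg k le_rfl hl0.le ξ
    positivity
  have heq : ∀ ξ : V, ξ ≠ 0 → Set.EqOn (κ · ξ) (fun l ↦ ‖ξ‖ ^ (-(2 * k : ℝ)) *
      Real.rpowIntegrand₀₁ a l (‖ξ‖ ^ (-2 : ℝ))) (Set.Ioi 0) := fun ξ hξ l hl ↦
    rpow_mul_inv_regularisedWeight k ha hl hξ
  have hInt : ∀ᵐ ξ : V, Integrable (κ · ξ) (volume.restrict (Set.Ioi (0 : ℝ))) := by
    filter_upwards [hne] with ξ hξ
    refine IntegrableOn.congr_fun ?_ (heq ξ hξ).symm measurableSet_Ioi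
    exact (Real.integrableOn_rpowIntegrand₀₁_Ioi ha (by positivity)).const_mul _
  have hΦ : ∀ᵐ ξ : V, ∫ l in Set.Ioi (0 : ℝ), κ l ξ = c * ‖ξ‖ ^ (-(2 * (k + a))) := by
    filter_upwards [hne] with ξ hξ
    have h0 : 0 < ‖ξ‖ := norm_pos_iff.2 hξ
    rw [setIntegral_congr_fun measurableSet_Ioi (heq ξ hξ), integral_const_mul,
      Real.integral_rpowIntegrand₀₁_eq_rpow_mul_const ha (by positivity), ← hc,
      ← Real.rpow_mul h0.le, ← mul_assoc, ← Real.rpow_add h0, mul_comm]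
    ring_nf
  have hΦH : Integrable fun ξ ↦ c * ‖ξ‖ ^ (-(2 * (k + a))) * ‖H ξ‖ := by
    simpa only [mul_assoc] using hi.const_mul c
  have hmul : ∀ l : ℝ, l ^ (a - 1) * ∫ ξ, H ξ * (regularisedWeight k 0 l ξ)⁻¹ =
      ∫ ξ, κ l ξ • H ξ := fun l ↦ by
    rw [← integral_const_mul]
    congr 1 with ξ
    simp only [hκdef, smul_eq_mul]
    ring
  simp_rw [hmul]
  refine ⟨(integrable_mixture hκ hκ0 hInt hΦ hH hΦH).integral_prod_left, ?_⟩
  rw [integral_mixture hκ hκ0 hInt hΦ hH hΦH, ← integral_const_mul]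
  simp only [smul_eq_mul, mul_assoc]

theorem SchwartzMap.integrable_rpow_mul_norm_sq [Nontrivial V] (f : 𝓢(V, ℂ)) {β : ℝ} (hβ0 : 0 ≤ β)
    (hβ : β < Module.finrank ℝ V) : Integrable fun ξ ↦ ‖ξ‖ ^ (-β) * ‖‖f ξ‖ ^ 2‖ := by
  have hb := (SchwartzMap.toBoundedContinuousFunction f).norm_coe_le_norm
  refine integrable_rpow_mul_norm hβ0 hβ (g := fun ξ ↦ ‖f ξ‖ ^ 2)
    (B := ‖SchwartzMap.toBoundedContinuousFunction f‖ ^ 2) ?_ fun x ↦ ?_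
  · have := (f.memLp 2 volume).integrable_norm_rpow (by norm_num) (by norm_num)
    simpa using this
  · rw [norm_pow, norm_norm]
    exact pow_le_pow_left₀ (norm_nonneg _) (hb x) 2

theorem SchwartzMap.exists_norm_transportSymbol_le {ι : Type*} [Fintype ι]
    (b : OrthonormalBasis ι ℝ V) (u : 𝓢(V, V)) (μ : 𝓢(V, ℂ)) :
    ∃ B, ∀ ξ, ‖transportSymbol b u μ ξ‖ ≤ B := by
  refine ⟨∑ i, ‖SchwartzMap.toBoundedContinuousFunction (𝓕 (component u μ (b i)))‖ *
    ‖SchwartzMap.toBoundedContinuousFunction (𝓕 (∂_{b i} μ : 𝓢(V, ℂ)))‖, fun ξ ↦ ?_⟩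
  refine (norm_sum_le _ _).trans (Finset.sum_le_sum fun i _ ↦ ?_)
  refine (norm_inner_le_norm _ _).trans ?_
  gcongr
  · exact (SchwartzMap.toBoundedContinuousFunction (𝓕 (component u μ (b i)))).norm_coe_le_norm ξ
  · exact (SchwartzMap.toBoundedContinuousFunction
      (𝓕 (∂_{b i} μ : 𝓢(V, ℂ)))).norm_coe_le_norm ξ

theorem SchwartzMap.integrable_rpow_mul_norm_re_transportSymbol [Nontrivial V] {ι : Type*}
    [Fintype ι] (b : OrthonormalBasis ι ℝ V) (u : 𝓢(V, V)) (μ : 𝓢(V, ℂ)) {β : ℝ} (hβ0 : 0 ≤ β)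
    (hβ : β < Module.finrank ℝ V) :
    Integrable fun ξ ↦ ‖ξ‖ ^ (-β) * ‖(transportSymbol b u μ ξ).re‖ := by
  obtain ⟨B, hB⟩ := exists_norm_transportSymbol_le b u μ
  exact integrable_rpow_mul_norm hβ0 hβ (integrable_transportSymbol b u μ).re
    fun ξ ↦ (Complex.abs_re_le_norm _).trans (hB ξ)

theorem SchwartzMap.exists_integral_rpow_mul_transportSymbol_le [Nontrivial V] {k : ℕ} (hk : 0 < k)
    {a : ℝ} (ha : a ∈ Set.Ioo (0 : ℝ) 1) (hkd : 2 * (k + a) < Module.finrank ℝ V)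
    {ι : Type*} [Fintype ι] (b : OrthonormalBasis ι ℝ V) :
    ∃ C : ℝ, 0 ≤ C ∧ ∀ (u : 𝓢(V, V)) (μ : 𝓢(V, ℂ)) (M : ℝ), (∀ x, ‖fderiv ℝ u x‖ ≤ M) →
      ∫ ξ, ‖ξ‖ ^ (-(2 * (k + a))) * (transportSymbol b u μ ξ).re ≤
        C * (M + (eLpNorm (iteratedFDeriv ℝ (k + 1) u)
          ((Module.finrank ℝ V : ℝ≥0) / k : ℝ≥0) volume).toReal) *
        ∫ ξ, ‖ξ‖ ^ (-(2 * (k + a))) * ‖𝓕 μ ξ‖ ^ 2 := by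
  have ha0 : 0 < a := ha.1
  have hkd' : (2 * k : ℝ) < Module.finrank ℝ V := by linarith
  obtain ⟨C, hC, h⟩ := exists_integral_transportSymbol_regularised_le (V := V) k hk
    (by exact_mod_cast hkd') b
  refine ⟨C, hC, fun u μ M hM ↦ ?_⟩
  set N := C * (M + (eLpNorm (iteratedFDeriv ℝ (k + 1) u)
    ((Module.finrank ℝ V : ℝ≥0) / k : ℝ≥0) volume).toReal)
  have hGm : AEStronglyMeasurable fun ξ ↦ (transportSymbol b u μ ξ).re :=
    (Complex.continuous_re.comp (continuous_transportSymbol b u μ)).aestronglyMeasurable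
  have hFm : AEStronglyMeasurable fun ξ ↦ ‖𝓕 μ ξ‖ ^ 2 :=
    ((𝓕 μ).continuous.norm.pow 2).aestronglyMeasurable
  have hlim : ∀ l : ℝ, 0 < l →
      ∫ ξ, (transportSymbol b u μ ξ).re * (regularisedWeight k 0 l ξ)⁻¹ ≤
        N * ∫ ξ, ‖𝓕 μ ξ‖ ^ 2 * (regularisedWeight k 0 l ξ)⁻¹ := fun l hl ↦ by
    refine le_of_tendsto_of_tendsto
      (tendsto_integral_mul_inv_regularisedWeight k hl.le hGm
        (integrable_rpow_mul_norm_re_transportSymbol b u μ (by positivity) hkd'))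
      ((tendsto_integral_mul_inv_regularisedWeight k hl.le hFm
        (integrable_rpow_mul_norm_sq (𝓕 μ) (by positivity) hkd')).const_mul N) ?_
    filter_upwards [self_mem_nhdsWithin] with ε hε
    exact h u μ M hM ε l hε hl.le
  obtain ⟨hG1, hG2⟩ := integral_rpow_mul_integral_inv_regularisedWeight k ha hGm
    (integrable_rpow_mul_norm_re_transportSymbol b u μ (by positivity) hkd)
  obtain ⟨hF1, hF2⟩ := integral_rpow_mul_integral_inv_regularisedWeight k ha hFm
    (integrable_rpow_mul_norm_sq (𝓕 μ) (by positivity) hkd)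
  have hmono := integral_mono_ae hG1 (hF1.const_mul N) (by
    filter_upwards [ae_restrict_mem measurableSet_Ioi] with l hl
    have hl0 : 0 < l := hl
    rw [mul_left_comm]
    exact mul_le_mul_of_nonneg_left (hlim l hl0) (by positivity))
  rw [integral_const_mul, hG2, hF2, mul_left_comm] at hmono
  exact le_of_mul_le_mul_left hmono (Real.integral_rpowIntegrand₀₁_one_pos ha)

end Fractional

section GaussianPairing

variable {V : Type*} [NormedAddCommGroup V] [InnerProductSpace ℝ V]
  [FiniteDimensional ℝ V] [MeasurableSpace V] [BorelSpace V]

theorem SchwartzMap.integrable_gaussian_smul (g : 𝓢(V, ℂ)) {t : ℝ} (ht : 0 < t) :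
    Integrable fun w ↦ Real.exp (-(t * ‖w‖ ^ 2)) • g w := by
  refine g.integrable.norm.mono' (Continuous.aestronglyMeasurable (by fun_prop)) ?_
  refine Eventually.of_forall fun w ↦ ?_
  rw [norm_smul, Real.norm_of_nonneg (Real.exp_pos _).le]
  exact mul_le_of_le_one_left (norm_nonneg _) (Real.exp_le_one_iff.2 (by
    have : 0 ≤ t * ‖w‖ ^ 2 := by positivity
    linarith))

theorem SchwartzMap.integral_gaussian_mul (ψ : 𝓢(V, ℂ)) {t : ℝ} (ht : 0 < t) (x : V) :
    ∫ y, ((Real.pi / t) ^ (Module.finrank ℝ V / 2 : ℝ) *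
        Real.exp (-(Real.pi ^ 2 * ‖x - y‖ ^ 2 / t))) • ψ y =
      𝓕⁻ (fun w ↦ Real.exp (-(t * ‖w‖ ^ 2)) • 𝓕 ψ w) x := by
  set g : V → ℂ := fun v ↦
    Complex.exp (-(t : ℂ) * ‖v‖ ^ 2 + 2 * Real.pi * Complex.I * inner ℝ x v) with hg
  have hre : 0 < (t : ℂ).re := ht
  have hgi : Integrable g := GaussianFourier.integrable_cexp_neg_mul_sq_norm_add hre _ x
  have h : ∫ ξ, 𝓕 ψ ξ * g ξ = ∫ y, ψ y * 𝓕 g y :=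
    VectorFourier.integral_bilin_fourierIntegral_eq_flip (L := innerₗ V)
      (ContinuousLinearMap.mul ℂ ℂ) Real.continuous_fourierChar continuous_inner
      ψ.integrable hgi |>.trans (by
        simp only [flip_innerₗ]
        rfl)
  have hF : ∀ y, 𝓕 g y = (((Real.pi / t) ^ (Module.finrank ℝ V / 2 : ℝ) *
        Real.exp (-(Real.pi ^ 2 * ‖x - y‖ ^ 2 / t)) : ℝ) : ℂ) := fun y ↦ by
    rw [hg, fourier_gaussian_innerProductSpace' hre x y, Complex.ofReal_mul,
      Complex.ofReal_cpow (by positivity), Complex.ofReal_exp]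
    push_cast
    ring_nf
  simp_rw [hF] at h
  rw [Real.fourierInv_eq']
  simp_rw [Complex.real_smul, smul_eq_mul]
  refine (integral_congr_ae (Eventually.of_forall fun y ↦ ?_)).trans
    (h.symm.trans (integral_congr_ae (Eventually.of_forall fun w ↦ ?_)))
  · exact mul_comm _ _
  · simp only [hg]
    rw [real_inner_comm, Complex.exp_add]
    push_cast
    ring_nf

theorem SchwartzMap.integral_integral_gaussian_mul_inner (φ ψ : 𝓢(V, ℂ)) {t : ℝ} (ht : 0 < t) :
    ∫ x, ∫ y, ((Real.pi / t) ^ (Module.finrank ℝ V / 2 : ℝ) *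
        Real.exp (-(Real.pi ^ 2 * ‖x - y‖ ^ 2 / t))) • inner ℂ (φ x) (ψ y) =
      ∫ w, Real.exp (-(t * ‖w‖ ^ 2)) • inner ℂ (𝓕 φ w) (𝓕 ψ w) := by
  have h := VectorFourier.integral_sesq_fourierIntegral_eq_neg_flip (innerSL ℂ)
    (L := innerₗ V) Real.continuous_fourierChar continuous_inner (φ.integrable (μ := volume))
    (integrable_gaussian_smul (𝓕 ψ) ht)
  have hR : ∀ x, ∫ y, ((Real.pi / t) ^ (Module.finrank ℝ V / 2 : ℝ) *
      Real.exp (-(Real.pi ^ 2 * ‖x - y‖ ^ 2 / t))) • inner ℂ (φ x) (ψ y) =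
      inner ℂ (φ x) (𝓕⁻ (fun w ↦ Real.exp (-(t * ‖w‖ ^ 2)) • 𝓕 ψ w) x) := fun x ↦ by
    rw [← integral_gaussian_mul ψ ht x]
    simp only [RCLike.inner_apply, ← smul_mul_assoc, integral_mul_const]
  simp_rw [hR]
  refine Eq.trans ?_ (h.symm.trans ?_)
  · simp only [flip_innerₗ]
    rfl
  · refine integral_congr_ae (Eventually.of_forall fun w ↦ ?_)
    simp only [innerSL_apply_apply]
    rw [← Complex.coe_smul, inner_smul_right, Complex.real_smul]
    rfl

end GaussianPairing

section RieszFourier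

theorem integral_rpow_mul_exp_neg_mul_sq {s r : ℝ} (hs : 0 < s) (hr : 0 < r) :
    IntegrableOn (fun t : ℝ ↦ t ^ (s - 1) * Real.exp (-(t * r ^ 2))) (Set.Ioi 0) ∧
    ∫ t in Set.Ioi (0 : ℝ), t ^ (s - 1) * Real.exp (-(t * r ^ 2)) =
      Real.Gamma s * r ^ (-(2 * s)) := by
  have h := Real.integral_rpow_mul_exp_neg_mul_Ioi hs (r := r ^ 2) (by positivity)
  have h1 : (1 / r ^ 2) ^ s = r ^ (-(2 * s)) := by
    rw [one_div, ← Real.rpow_natCast, ← Real.rpow_neg hr.le, ← Real.rpow_mul hr.le]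
    norm_num
  simp_rw [mul_comm (r ^ 2), h1, mul_comm _ (Real.Gamma s)] at h
  exact ⟨.of_integral_ne_zero (by
    rw [h]
    have := Real.Gamma_pos_of_pos hs
    positivity), h⟩

theorem integral_rpow_mul_gaussian {n α r : ℝ} (hα : 0 < α) (hr : 0 < r) :
    IntegrableOn (fun t : ℝ ↦ t ^ ((n - α) / 2 - 1) * ((Real.pi / t) ^ (n / 2) *
      Real.exp (-(Real.pi ^ 2 * r ^ 2 / t)))) (Set.Ioi 0) ∧
    ∫ t in Set.Ioi (0 : ℝ), t ^ ((n - α) / 2 - 1) * ((Real.pi / t) ^ (n / 2) *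
      Real.exp (-(Real.pi ^ 2 * r ^ 2 / t))) =
      Real.pi ^ (n / 2) * Real.Gamma (α / 2) * Real.pi ^ (-α) * r ^ (-α) := by
  have hpr : 0 < Real.pi * r := by positivity
  obtain ⟨h1, h2⟩ := integral_rpow_mul_exp_neg_mul_sq (half_pos hα) hpr
  set g : ℝ → ℝ := fun t ↦ t ^ (α / 2 - 1) * Real.exp (-(t * (Real.pi * r) ^ 2))
  have heq : Set.EqOn (fun t : ℝ ↦ Real.pi ^ (n / 2) * ((|(-1 : ℝ)| * t ^ ((-1 : ℝ) - 1)) •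
      g (t ^ (-1 : ℝ)))) (fun t : ℝ ↦ t ^ ((n - α) / 2 - 1) * ((Real.pi / t) ^ (n / 2) *
      Real.exp (-(Real.pi ^ 2 * r ^ 2 / t)))) (Set.Ioi 0) := fun t ht ↦ by
    have ht0 : 0 < t := ht
    simp only [g, smul_eq_mul, abs_neg, abs_one, one_mul]
    rw [Real.div_rpow Real.pi_pos.le ht0.le, ← Real.rpow_mul ht0.le, Real.rpow_neg_one,
      div_eq_mul_inv _ (t ^ (n / 2)), ← Real.rpow_neg ht0.le,
      show t⁻¹ * (Real.pi * r) ^ 2 = Real.pi ^ 2 * r ^ 2 / t by ring]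
    have e : t ^ ((n - α) / 2 - 1) * t ^ (-(n / 2)) =
        t ^ ((-1 : ℝ) - 1) * t ^ (-1 * (α / 2 - 1)) := by
      rw [← Real.rpow_add ht0, ← Real.rpow_add ht0]
      ring_nf
    linear_combination (-(Real.pi ^ (n / 2) * Real.exp (-(Real.pi ^ 2 * r ^ 2 / t)))) * e
  constructor
  · refine IntegrableOn.congr_fun ?_ heq measurableSet_Ioi
    exact ((integrableOn_Ioi_comp_rpow_iff g (by norm_num)).2 h1).const_mul _
  · rw [← setIntegral_congr_fun measurableSet_Ioi heq, integral_const_mul,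
      integral_comp_rpow_Ioi g (by norm_num), h2, Real.mul_rpow Real.pi_pos.le hr.le]
    ring_nf

variable {V : Type*} [NormedAddCommGroup V] [InnerProductSpace ℝ V]
  [FiniteDimensional ℝ V] [MeasurableSpace V] [BorelSpace V]

theorem ae_prod_ne [Nontrivial V] : ∀ᵐ z : V × V, z.1 ≠ z.2 := by
  rw [Measure.volume_eq_prod]
  refine (Measure.ae_prod_iff_ae_ae ?_).2 (Eventually.of_forall fun x ↦ ?_)
  · exact (measurableSet_eq_fun measurable_fst measurable_snd).compl
  · simp [ae_iff]

theorem SchwartzMap.integrable_prod_inner (φ ψ : 𝓢(V, ℂ)) :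
    Integrable fun z : V × V ↦ inner ℂ (φ z.1) (ψ z.2) := by
  have h : Integrable (fun z : V × V ↦ ‖φ z.1‖ * ‖ψ z.2‖) :=
    (φ.integrable (μ := volume)).norm.mul_prod (ψ.integrable (μ := volume)).norm
  exact h.mono' (by fun_prop : Continuous fun z : V × V ↦
    inner ℂ (φ z.1) (ψ z.2)).aestronglyMeasurable
      (Eventually.of_forall fun z ↦ norm_inner_le_norm _ _)

theorem SchwartzMap.integrable_prod_rpow_mul_norm_inner [Nontrivial V] (φ ψ : 𝓢(V, ℂ)) {α : ℝ}
    (hα : 0 ≤ α) (hαd : α < Module.finrank ℝ V) :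
    Integrable fun z : V × V ↦ ‖z.1 - z.2‖ ^ (-α) * ‖inner ℂ (φ z.1) (ψ z.2)‖ := by
  have := integrable_prod_rpow_mul_norm_mul_norm hα hαd (φ.integrable (μ := volume))
    (ψ.integrable (μ := volume)) (SchwartzMap.toBoundedContinuousFunction ψ).norm_coe_le_norm
  refine this.congr (Eventually.of_forall fun z ↦ ?_)
  simp [mul_comm]

theorem SchwartzMap.integrable_prod_rpow_smul_inner [Nontrivial V] (φ ψ : 𝓢(V, ℂ)) {α : ℝ}
    (hα : 0 ≤ α) (hαd : α < Module.finrank ℝ V) :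
    Integrable fun z : V × V ↦ ‖z.1 - z.2‖ ^ (-α) • inner ℂ (φ z.1) (ψ z.2) := by
  refine (integrable_prod_rpow_mul_norm_inner φ ψ hα hαd).mono' ?_ ?_
  · exact (by fun_prop : Measurable fun z : V × V ↦ ‖z.1 - z.2‖ ^ (-α)).aestronglyMeasurable.smul
      (integrable_prod_inner φ ψ).aestronglyMeasurable
  · refine Eventually.of_forall fun z ↦ ?_
    rw [norm_smul, Real.norm_of_nonneg (by positivity)]

/-- The Fourier side expression of the Riesz interaction energy. -/
theorem SchwartzMap.exists_integral_integral_rpow_smul_inner [Nontrivial V] {α : ℝ} (hα : 0 < α)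
    (hαd : α < Module.finrank ℝ V) : ∃ c : ℝ, 0 < c ∧ ∀ φ ψ : 𝓢(V, ℂ),
      ∫ x, ∫ y, ‖x - y‖ ^ (-α) • inner ℂ (φ x) (ψ y) =
        c • ∫ w, ‖w‖ ^ (-(Module.finrank ℝ V - α)) • inner ℂ (𝓕 φ w) (𝓕 ψ w) := by
  set n : ℝ := ((Module.finrank ℝ V : ℕ) : ℝ) with hn
  set s := (n - α) / 2 with hs
  have hs0 : 0 < s := by rw [hs]; linarith
  set c₁ := Real.pi ^ (n / 2) * Real.Gamma (α / 2) * Real.pi ^ (-α)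
  have hc₁ : 0 < c₁ := by
    have := Real.Gamma_pos_of_pos (half_pos hα)
    have := Real.pi_pos
    positivity
  have hc₂ := Real.Gamma_pos_of_pos hs0
  refine ⟨c₁⁻¹ * Real.Gamma s, by positivity, fun φ ψ ↦ ?_⟩
  have hpos : ∀ᵐ t ∂volume.restrict (Set.Ioi (0 : ℝ)), 0 < t := ae_restrict_mem measurableSet_Ioi
  -- physical side
  have hA := integral_mixture (ν := volume.restrict (Set.Ioi (0 : ℝ)))
    (P := (volume : Measure (V × V)))
    (κ := fun t z ↦ t ^ (s - 1) * ((Real.pi / t) ^ (n / 2) *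
      Real.exp (-(Real.pi ^ 2 * ‖z.1 - z.2‖ ^ 2 / t))))
    (Φ := fun z ↦ c₁ * ‖z.1 - z.2‖ ^ (-α)) (H := fun z ↦ inner ℂ (φ z.1) (ψ z.2))
    (Measurable.aestronglyMeasurable (by unfold Function.uncurry; fun_prop))
    (hpos.mono fun t ht z ↦ by have := Real.pi_pos; positivity)
    (ae_prod_ne.mono fun z hz ↦
      (integral_rpow_mul_gaussian hα (norm_pos_iff.2 (sub_ne_zero.2 hz))).1)
    (ae_prod_ne.mono fun z hz ↦
      (integral_rpow_mul_gaussian hα (norm_pos_iff.2 (sub_ne_zero.2 hz))).2)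
    (integrable_prod_inner φ ψ).aestronglyMeasurable
    (by simpa only [mul_assoc] using
      (integrable_prod_rpow_mul_norm_inner φ ψ hα.le hαd).const_mul c₁)
  -- Fourier side
  have hne : ∀ᵐ w : V, w ≠ 0 := by simp [ae_iff]
  have hB := integral_mixture (ν := volume.restrict (Set.Ioi (0 : ℝ)))
    (P := (volume : Measure V))
    (κ := fun t w ↦ t ^ (s - 1) * Real.exp (-(t * ‖w‖ ^ 2)))
    (Φ := fun w ↦ Real.Gamma s * ‖w‖ ^ (-(2 * s)))
    (H := fun w ↦ inner ℂ (𝓕 φ w) (𝓕 ψ w))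
    (Measurable.aestronglyMeasurable (by unfold Function.uncurry; fun_prop))
    (hpos.mono fun t ht z ↦ by positivity)
    (hne.mono fun w hw ↦ (integral_rpow_mul_exp_neg_mul_sq hs0 (norm_pos_iff.2 hw)).1)
    (hne.mono fun w hw ↦ (integral_rpow_mul_exp_neg_mul_sq hs0 (norm_pos_iff.2 hw)).2)
    (integrable_inner (𝓕 φ) (𝓕 ψ)).aestronglyMeasurable (by
      simp only [mul_assoc]
      refine Integrable.const_mul ?_ _
      refine integrable_rpow_mul_norm (by linarith) (by linarith) (integrable_inner (𝓕 φ) (𝓕 ψ))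
        (B := ‖SchwartzMap.toBoundedContinuousFunction (𝓕 φ)‖ *
          ‖SchwartzMap.toBoundedContinuousFunction (𝓕 ψ)‖) fun w ↦ ?_
      refine (norm_inner_le_norm _ _).trans ?_
      gcongr
      · exact (SchwartzMap.toBoundedContinuousFunction (𝓕 φ)).norm_coe_le_norm w
      · exact (SchwartzMap.toBoundedContinuousFunction (𝓕 ψ)).norm_coe_le_norm w)
  have hAB : ∀ t : ℝ, 0 < t → ∫ z : V × V, (t ^ (s - 1) * ((Real.pi / t) ^ (n / 2) *
      Real.exp (-(Real.pi ^ 2 * ‖z.1 - z.2‖ ^ 2 / t)))) • inner ℂ (φ z.1) (ψ z.2) =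
      ∫ w, (t ^ (s - 1) * Real.exp (-(t * ‖w‖ ^ 2))) • inner ℂ (𝓕 φ w) (𝓕 ψ w) := fun t ht ↦ by
    simp only [mul_smul (t ^ (s - 1)), integral_smul]
    rw [← integral_integral_gaussian_mul_inner φ ψ ht]
    congr 1
    rw [Measure.volume_eq_prod, integral_prod]
    refine (integrable_prod_inner φ ψ).norm.const_mul ((Real.pi / t) ^ (n / 2)) |>.mono' ?_ ?_
    · exact (by fun_prop : Measurable fun z : V × V ↦
        (Real.pi / t) ^ (n / 2) * Real.exp (-(Real.pi ^ 2 * ‖z.1 - z.2‖ ^ 2 / t))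
          ).aestronglyMeasurable.smul (integrable_prod_inner φ ψ).aestronglyMeasurable
    · refine Eventually.of_forall fun z ↦ ?_
      have := Real.pi_pos
      rw [norm_smul, Real.norm_of_nonneg (by positivity)]
      gcongr
      refine mul_le_of_le_one_right (by positivity) (Real.exp_le_one_iff.2 ?_)
      rw [neg_nonpos]
      positivity
  rw [setIntegral_congr_fun measurableSet_Ioi fun t ht ↦ hAB t ht, hB] at hA
  have hprod : ∫ x, ∫ y, ‖x - y‖ ^ (-α) • inner ℂ (φ x) (ψ y) =
      ∫ z : V × V, ‖z.1 - z.2‖ ^ (-α) • inner ℂ (φ z.1) (ψ z.2) := by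
    rw [Measure.volume_eq_prod, integral_prod]
    exact integrable_prod_rpow_smul_inner φ ψ hα.le hαd
  have h2s : 2 * s = n - α := by rw [hs]; ring
  simp only [mul_smul _ _ (inner ℂ (_ : ℂ) (_ : ℂ)), integral_smul, h2s] at hA
  rw [hprod, mul_smul, hA, inv_smul_smul₀ hc₁.ne']

end RieszFourier

section IntegrationByParts

theorem regularised_rpow_le {V : Type*} [NormedAddCommGroup V] {δ β : ℝ} (hδ : 0 ≤ δ)
    (hβ : 0 ≤ β) {z : V} (hz : z ≠ 0) :
    (δ + ‖z‖ ^ 2) ^ (-β / 2) ≤ ‖z‖ ^ (-β) := by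
  have h0 : 0 < ‖z‖ := norm_pos_iff.2 hz
  calc (δ + ‖z‖ ^ 2) ^ (-β / 2) ≤ (‖z‖ ^ 2) ^ (-β / 2) :=
        Real.rpow_le_rpow_of_nonpos (by positivity) (by linarith) (by linarith)
    _ = ‖z‖ ^ (-β) := by
        rw [← Real.rpow_natCast, ← Real.rpow_mul h0.le]
        congr 1
        push_cast
        ring

theorem tendsto_regularised_rpow {V : Type*} [NormedAddCommGroup V] (β : ℝ) {z : V} (hz : z ≠ 0) :
    Tendsto (fun δ : ℝ ↦ (δ + ‖z‖ ^ 2) ^ (-β / 2)) (𝓝[>] 0) (𝓝 (‖z‖ ^ (-β))) := by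
  have h0 : 0 < ‖z‖ := norm_pos_iff.2 hz
  have h1 : ‖z‖ ^ (-β) = (0 + ‖z‖ ^ 2) ^ (-β / 2) := by
    rw [zero_add, ← Real.rpow_natCast, ← Real.rpow_mul h0.le]
    congr 1
    push_cast
    ring
  rw [h1]
  refine Tendsto.mono_left ?_ nhdsWithin_le_nhds
  exact (ContinuousAt.rpow_const (by fun_prop) (Or.inl (by positivity))).tendsto

variable {V : Type*} [NormedAddCommGroup V] [InnerProductSpace ℝ V]

theorem hasFDerivAt_regularised_rpow {δ : ℝ} (hδ : 0 < δ) (p : ℝ) (x y : V) :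
    HasFDerivAt (fun y ↦ (δ + ‖x - y‖ ^ 2) ^ p)
      ((-(2 * p) * (δ + ‖x - y‖ ^ 2) ^ (p - 1)) • innerSL ℝ (x - y)) y := by
  have h1 : HasFDerivAt (fun y ↦ x - y) (-ContinuousLinearMap.id ℝ V) y :=
    (hasFDerivAt_id y).const_sub x
  have h2 := (h1.norm_sq.const_add δ).rpow_const (p := p) (Or.inl (by positivity))
  refine h2.congr_fderiv ?_
  ext v
  simp
  ring

variable [FiniteDimensional ℝ V] [MeasurableSpace V] [BorelSpace V]

theorem integral_mul_regularised_rpow_eq {μ : V → ℝ} (hμ : ContDiff ℝ (⊤ : ℕ∞) μ)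
    (hc : HasCompactSupport μ) {δ : ℝ} (hδ : 0 < δ) (p : ℝ) (x v : V) :
    ∫ y, μ y * (2 * p * (δ + ‖x - y‖ ^ 2) ^ (p - 1) * inner ℝ v (x - y)) =
      ∫ y, fderiv ℝ μ y v * (δ + ‖x - y‖ ^ 2) ^ p := by
  set g : V → ℝ := fun y ↦ (δ + ‖x - y‖ ^ 2) ^ p with hg
  have hd := hasFDerivAt_regularised_rpow hδ p x
  have hgc : Continuous g := continuous_iff_continuousAt.2 fun y ↦ (hd y).continuousAt
  have hpc : Continuous fun y ↦ (δ + ‖x - y‖ ^ 2) ^ (p - 1) :=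
    continuous_iff_continuousAt.2 fun y ↦ (hasFDerivAt_regularised_rpow hδ (p - 1) x y).continuousAt
  have hg' : ∀ y, fderiv ℝ g y v =
      -(2 * p * (δ + ‖x - y‖ ^ 2) ^ (p - 1) * inner ℝ v (x - y)) := fun y ↦ by
    rw [(hd y).fderiv, real_inner_comm]
    simp only [smul_apply, innerSL_apply_apply, smul_eq_mul]
    ring
  have hμc' : Continuous fun y ↦ fderiv ℝ μ y v :=
    (hμ.continuous_fderiv (by simp)).clm_apply continuous_const
  have hgc' : Continuous fun y ↦ fderiv ℝ g y v := by
    simp_rw [hg']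
    fun_prop
  have hcμ' : HasCompactSupport fun y ↦ fderiv ℝ μ y v := hc.fderiv_apply (𝕜 := ℝ) v
  have h := integral_mul_fderiv_eq_neg_fderiv_mul_of_integrable (μ := (volume : Measure V)) (v := v)
    ((hμc'.mul hgc).integrable_of_hasCompactSupport hcμ'.mul_right)
    ((hμ.continuous.mul hgc').integrable_of_hasCompactSupport hc.mul_right)
    ((hμ.continuous.mul hgc).integrable_of_hasCompactSupport hc.mul_right)
    (fun y _ ↦ hμ.differentiable (by simp) y) (fun y _ ↦ (hd y).differentiableAt)
  simp_rw [hg', mul_neg, integral_neg, neg_inj] at h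
  exact h

/-- Integration by parts against the Riesz kernel. -/
theorem integral_mul_riesz_gradient_eq [Nontrivial V] {μ : V → ℝ} (hμ : ContDiff ℝ (⊤ : ℕ∞) μ)
    (hc : HasCompactSupport μ) {α : ℝ} (hα : 0 ≤ α) (hαd : α + 1 < Module.finrank ℝ V) (x v : V) :
    ∫ y, μ y * (-α * ‖x - y‖ ^ (-α - 2) * inner ℝ v (x - y)) =
      ∫ y, fderiv ℝ μ y v * ‖x - y‖ ^ (-α) := by
  have hne : ∀ᵐ y : V, x - y ≠ 0 := by
    simp only [ne_eq, sub_eq_zero, ae_iff, not_not]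
    simp
  have hμc' : Continuous fun y ↦ fderiv ℝ μ y v :=
    (hμ.continuous_fderiv (by simp)).clm_apply continuous_const
  have hcμ' : HasCompactSupport fun y ↦ fderiv ℝ μ y v := hc.fderiv_apply (𝕜 := ℝ) v
  obtain ⟨B, hB⟩ := hc.exists_bound_of_continuous hμ.continuous
  obtain ⟨B', hB'⟩ := hcμ'.exists_bound_of_continuous hμc'
  obtain ⟨A, hA⟩ := exists_integrable_norm_mul_rpow (by linarith) hαd
    (hμ.continuous.integrable_of_hasCompactSupport hc) hB
  obtain ⟨A', hA'⟩ := exists_integrable_norm_mul_rpow hα (by linarith)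
    (hμc'.integrable_of_hasCompactSupport hcμ') hB'
  have hL : Tendsto (fun δ : ℝ ↦ ∫ y, μ y * (2 * (-α / 2) * (δ + ‖x - y‖ ^ 2) ^ (-α / 2 - 1) *
      inner ℝ v (x - y))) (𝓝[>] 0)
      (𝓝 (∫ y, μ y * (-α * ‖x - y‖ ^ (-α - 2) * inner ℝ v (x - y)))) := by
    refine tendsto_integral_filter_of_dominated_convergence _ ?_ ?_
      ((hA x).1.const_mul (α * ‖v‖)) ?_
    · exact Eventually.of_forall fun δ ↦ hμ.continuous.aestronglyMeasurable.mul
        (Measurable.aestronglyMeasurable (by fun_prop))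
    · filter_upwards [self_mem_nhdsWithin] with δ hδ
      filter_upwards [hne] with y hy
      have hδ0 : 0 < δ := hδ
      have h0 : 0 < ‖x - y‖ := norm_pos_iff.2 hy
      have e1 : -α / 2 - 1 = -(α + 2) / 2 := by ring
      have h1 := regularised_rpow_le hδ0.le (by linarith : 0 ≤ α + 2) hy
      have h2 : ‖x - y‖ ^ (-(α + 2)) * ‖x - y‖ = ‖x - y‖ ^ (-(α + 1)) := by
        nth_rw 2 [← Real.rpow_one ‖x - y‖]
        rw [← Real.rpow_add h0]
        ring_nf
      have h3 := norm_inner_le_norm (𝕜 := ℝ) v (x - y)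
      have e2 : ‖(2 * (-α / 2) : ℝ)‖ = α := by
        rw [show (2 * (-α / 2) : ℝ) = -α by ring, norm_neg, Real.norm_of_nonneg hα]
      rw [norm_mul, norm_mul, norm_mul, e2, e1, Real.norm_of_nonneg (by positivity :
        0 ≤ (δ + ‖x - y‖ ^ 2) ^ (-(α + 2) / 2))]
      calc ‖μ y‖ * (α * (δ + ‖x - y‖ ^ 2) ^ (-(α + 2) / 2) * ‖inner ℝ v (x - y)‖)
          ≤ ‖μ y‖ * (α * ‖x - y‖ ^ (-(α + 2)) * (‖v‖ * ‖x - y‖)) := by gcongr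
        _ = _ := by rw [← h2]; ring
    · filter_upwards [hne] with y hy
      refine Tendsto.const_mul _ (Tendsto.mul_const _ ?_)
      have h := tendsto_regularised_rpow (α + 2) hy
      have e1 : -α / 2 - 1 = -(α + 2) / 2 := by ring
      have e2 : -α - 2 = -(α + 2) := by ring
      rw [e1, e2, show (2 * (-α / 2) : ℝ) = -α by ring]
      exact h.const_mul _
  have hR : Tendsto (fun δ : ℝ ↦ ∫ y, fderiv ℝ μ y v * (δ + ‖x - y‖ ^ 2) ^ (-α / 2)) (𝓝[>] 0)
      (𝓝 (∫ y, fderiv ℝ μ y v * ‖x - y‖ ^ (-α))) := by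
    refine tendsto_integral_filter_of_dominated_convergence _ ?_ ?_ (hA' x).1 ?_
    · exact Eventually.of_forall fun δ ↦ hμc'.aestronglyMeasurable.mul
        (Measurable.aestronglyMeasurable (by fun_prop))
    · filter_upwards [self_mem_nhdsWithin] with δ hδ
      filter_upwards [hne] with y hy
      have hδ0 : 0 < δ := hδ
      rw [norm_mul, mul_comm, Real.norm_of_nonneg (by positivity :
        0 ≤ (δ + ‖x - y‖ ^ 2) ^ (-α / 2))]
      gcongr
      exact regularised_rpow_le hδ0.le hα hy
    · filter_upwards [hne] with y hy
      exact (tendsto_regularised_rpow α hy).const_mul _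
  refine tendsto_nhds_unique hL (hR.congr' ?_)
  filter_upwards [self_mem_nhdsWithin] with δ hδ
  exact (integral_mul_regularised_rpow_eq hμ hc hδ _ x v).symm

end IntegrationByParts

section FourierSide

variable {V : Type*} [NormedAddCommGroup V] [InnerProductSpace ℝ V]
  [FiniteDimensional ℝ V] [MeasurableSpace V] [BorelSpace V]

theorem SchwartzMap.ofReal_integral_transport_eq [Nontrivial V] {ι : Type*} [Fintype ι]
    (b : OrthonormalBasis ι ℝ V) {μ : V → ℝ} (hμ : ContDiff ℝ (⊤ : ℕ∞) μ)
    (hc : HasCompactSupport μ) {α : ℝ} (hα : 0 ≤ α) (hαd : α + 1 < Module.finrank ℝ V)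
    (m : 𝓢(V, ℂ)) (hm : ∀ x, m x = μ x) (u : 𝓢(V, V)) :
    ((∫ x, ∫ y, μ x * μ y * (-α * ‖x - y‖ ^ (-α - 2) * inner ℝ (u x) (x - y)) : ℝ) : ℂ) =
      ∑ i, ∫ x, ∫ y, ‖x - y‖ ^ (-α) •
        inner ℂ (component u m (b i) x) ((∂_{b i} m : 𝓢(V, ℂ)) y) := by
  have hder : ∀ v y, (∂_{v} m : 𝓢(V, ℂ)) y = (fderiv ℝ μ y v : ℝ) := fun v y ↦ by
    have h1 : (m : V → ℂ) = Complex.ofRealCLM ∘ μ := funext hm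
    rw [lineDerivOp_apply_eq_fderiv, h1,
      (Complex.ofRealCLM.hasFDerivAt.comp y (hμ.differentiable (by simp) y).hasFDerivAt).fderiv]
    rfl
  have hi : ∀ i, Integrable fun z : V × V ↦ ‖z.1 - z.2‖ ^ (-α) •
      inner ℂ (component u m (b i) z.1) ((∂_{b i} m : 𝓢(V, ℂ)) z.2) := fun i ↦
    integrable_prod_rpow_smul_inner _ _ hα (by linarith)
  have hx : ∀ x, ∫ y, μ x * μ y * (-α * ‖x - y‖ ^ (-α - 2) * inner ℝ (u x) (x - y)) =
      ∫ y, μ x * (fderiv ℝ μ y (u x) * ‖x - y‖ ^ (-α)) := fun x ↦ by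
    simp only [mul_assoc (μ x), integral_const_mul]
    rw [integral_mul_riesz_gradient_eq hμ hc hα hαd]
  have hInt : ∀ i x, Integrable fun y ↦ ‖x - y‖ ^ (-α) •
      inner ℂ (component u m (b i) x) ((∂_{b i} m : 𝓢(V, ℂ)) y) := fun i x ↦ by
    obtain ⟨A, hA⟩ := exists_integrable_norm_mul_rpow hα (by linarith)
      ((∂_{b i} m : 𝓢(V, ℂ)).integrable (μ := volume))
      (SchwartzMap.toBoundedContinuousFunction (∂_{b i} m : 𝓢(V, ℂ))).norm_coe_le_norm
    refine ((hA x).1.const_mul ‖component u m (b i) x‖).mono' ?_ (Eventually.of_forall fun y ↦ ?_)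
    · exact (by fun_prop : Measurable fun y : V ↦ ‖x - y‖ ^ (-α)).aestronglyMeasurable.smul
        (by fun_prop : Continuous fun y ↦
          inner ℂ (component u m (b i) x) ((∂_{b i} m : 𝓢(V, ℂ)) y)).aestronglyMeasurable
    · rw [norm_smul, Real.norm_of_nonneg (by positivity), mul_left_comm]
      gcongr
      exact norm_inner_le_norm _ _
  rw [Measure.volume_eq_prod] at hi
  simp_rw [hx]
  rw [← integral_finsetSum _ fun i _ ↦ (hi i).integral_prod_left, ← integral_complex_ofReal]
  congr 1 with x
  rw [← integral_finsetSum _ fun i _ ↦ hInt i x, ← integral_complex_ofReal]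
  congr 1 with y
  conv_lhs => rw [← b.sum_repr' (u x)]
  rw [map_sum, Finset.sum_mul, Finset.mul_sum]
  push_cast
  refine Finset.sum_congr rfl fun i _ ↦ ?_
  rw [map_smul, hder, component_apply, hm]
  simp only [RCLike.inner_apply, map_mul, Complex.conj_ofReal, Complex.real_smul, smul_eq_mul]
  push_cast
  ring

theorem SchwartzMap.integrable_rpow_smul_inner [Nontrivial V] (φ ψ : 𝓢(V, ℂ)) {β : ℝ} (hβ0 : 0 ≤ β)
    (hβ : β < Module.finrank ℝ V) : Integrable fun w ↦ ‖w‖ ^ (-β) • inner ℂ (φ w) (ψ w) := by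
  have h := integrable_rpow_mul_norm hβ0 hβ (integrable_inner φ ψ)
    (B := ‖SchwartzMap.toBoundedContinuousFunction φ‖ *
      ‖SchwartzMap.toBoundedContinuousFunction ψ‖) fun w ↦ by
        refine (norm_inner_le_norm _ _).trans ?_
        gcongr
        · exact (SchwartzMap.toBoundedContinuousFunction φ).norm_coe_le_norm w
        · exact (SchwartzMap.toBoundedContinuousFunction ψ).norm_coe_le_norm w
  refine h.mono' ?_ (Eventually.of_forall fun w ↦ ?_)
  · exact (by fun_prop : Measurable fun w : V ↦ ‖w‖ ^ (-β)).aestronglyMeasurable.smul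
      (integrable_inner φ ψ).aestronglyMeasurable
  · rw [norm_smul, Real.norm_of_nonneg (by positivity)]

/-- The interaction energy and the transport term on the Fourier side. -/
theorem SchwartzMap.exists_integral_transport_eq_and_energy_eq [Nontrivial V] {ι : Type*}
    [Fintype ι] (b : OrthonormalBasis ι ℝ V) {α : ℝ} (hα : 0 < α)
    (hαd : α + 1 < Module.finrank ℝ V) : ∃ c : ℝ, 0 < c ∧ ∀ {μ : V → ℝ},
      ContDiff ℝ (⊤ : ℕ∞) μ → HasCompactSupport μ → ∀ m : 𝓢(V, ℂ), (∀ x, m x = μ x) →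
      (∀ u : 𝓢(V, V), ∫ x, ∫ y, μ x * μ y * (-α * ‖x - y‖ ^ (-α - 2) * inner ℝ (u x) (x - y)) =
        c * ∫ w, ‖w‖ ^ (-(Module.finrank ℝ V - α)) * (transportSymbol b u m w).re) ∧
      ∫ x, ∫ y, μ x * μ y * ‖x - y‖ ^ (-α) =
        c * ∫ w, ‖w‖ ^ (-(Module.finrank ℝ V - α)) * ‖𝓕 m w‖ ^ 2 := by
  obtain ⟨c, hc0, hc⟩ := exists_integral_integral_rpow_smul_inner (V := V) hα (by linarith)
  refine ⟨c, hc0, fun {μ} hμ hμc m hm ↦ ⟨fun u ↦ ?_, ?_⟩⟩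
  · have hi : ∀ i, Integrable fun w ↦ ‖w‖ ^ (-(Module.finrank ℝ V - α)) •
        inner ℂ (𝓕 (component u m (b i)) w) (𝓕 (∂_{b i} m : 𝓢(V, ℂ)) w) := fun i ↦
      integrable_rpow_smul_inner _ _ (by linarith) (by linarith)
    have h := ofReal_integral_transport_eq b hμ hμc hα.le hαd m hm u
    simp_rw [hc] at h
    rw [← Finset.smul_sum, ← integral_finsetSum _ fun i _ ↦ hi i] at h
    simp_rw [← Finset.smul_sum] at h
    have hInt : Integrable fun w ↦ ‖w‖ ^ (-(Module.finrank ℝ V - α)) •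
        transportSymbol b u m w := by
      simp only [transportSymbol, Finset.smul_sum]
      exact integrable_finsetSum _ fun i _ ↦ hi i
    have h' := congrArg Complex.re h
    rw [Complex.ofReal_re, Complex.smul_re, smul_eq_mul] at h'
    rw [h']
    congr 1
    have := integral_re hInt
    simp only [RCLike.re_to_complex, Complex.smul_re, smul_eq_mul] at this
    exact this.symm
  · have h := hc m m
    have h1 : ∫ x, ∫ y, ‖x - y‖ ^ (-α) • inner ℂ (m x) (m y) =
        ((∫ x, ∫ y, μ x * μ y * ‖x - y‖ ^ (-α) : ℝ) : ℂ) := by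
      simp_rw [← integral_complex_ofReal]
      congr 1 with x
      congr 1 with y
      rw [hm, hm]
      simp only [RCLike.inner_apply, Complex.conj_ofReal, Complex.real_smul]
      push_cast
      ring
    have h2 : ∫ w, ‖w‖ ^ (-(Module.finrank ℝ V - α)) • inner ℂ (𝓕 m w) (𝓕 m w) =
        ((∫ w, ‖w‖ ^ (-(Module.finrank ℝ V - α)) * ‖𝓕 m w‖ ^ 2 : ℝ) : ℂ) := by
      rw [← integral_complex_ofReal]
      congr 1 with w
      rw [inner_self_eq_norm_sq_to_K, Complex.real_smul]
      push_cast
      rfl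
    rw [h1, h2, Complex.real_smul] at h
    exact_mod_cast h

end FourierSide

theorem sobSeminorm_nonneg (d k : ℕ) (p : ℝ)
    (u : EuclideanSpace ℝ (Fin d) → EuclideanSpace ℝ (Fin d)) : 0 ≤ sobSeminorm d k p u := by
  unfold sobSeminorm
  positivity

theorem toReal_eLpNorm_iteratedFDeriv_eq_sobSeminorm {d : ℕ} (n : ℕ) {p : ℝ≥0} (hp : 0 < p)
    (u : 𝓢(EuclideanSpace ℝ (Fin d), EuclideanSpace ℝ (Fin d))) :
    (eLpNorm (iteratedFDeriv ℝ n u) p volume).toReal = sobSeminorm d n p u := by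
  rw [(u.memLp_iteratedFDeriv n p).eLpNorm_eq_integral_rpow_norm (by simpa using hp.ne')
    ENNReal.coe_ne_top, ENNReal.coe_toReal]
  exact ENNReal.toReal_ofReal (sobSeminorm_nonneg d n p u)

/-- Modulated interaction energy estimate for `K(x) = |x|^{-α}` with
`d ≥ 5`, `α ∈ (0, d-4)`, `α ≠ d - 2n` for every `n ∈ ℕ`, and `k = ⌊(d-α)/2⌋`:
there is `C > 0` depending only on `α, d` such that for any `μ ∈ C_c^∞(ℝ^d)` and
`u ∈ C_c^∞(ℝ^d;ℝ^d)`,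
`T(μ,u) ≤ C (‖∇u‖_{L^∞} + ‖∇^k u‖_{L^{d/(k-1)}} + ‖∇^{k+1} u‖_{L^{d/k}}) E(μ)`. -/
theorem stmt_2 (d : ℕ) (hd : 5 ≤ d) (α : ℝ)
    (hα₁ : 0 < α) (hα₂ : α < (d : ℝ) - 4)
    (hres : ∀ n : ℕ, α ≠ (d : ℝ) - 2 * n)
    (k : ℕ) (hk : k = ⌊((d : ℝ) - α) / 2⌋₊) :
    ∃ C : ℝ, 0 < C ∧
      ∀ μ : EuclideanSpace ℝ (Fin d) → ℝ,
        ContDiff ℝ (⊤ : ℕ∞) μ → HasCompactSupport μ →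
        ∀ u : EuclideanSpace ℝ (Fin d) → EuclideanSpace ℝ (Fin d),
          ContDiff ℝ (⊤ : ℕ∞) u → HasCompactSupport u →
          (∫ x, ∫ y, μ x * μ y *
              (-α * ‖x - y‖ ^ (-α - 2) * ∑ i, u x i * (x i - y i)))
            ≤ C * ((⨆ x, ‖fderiv ℝ u x‖)
                  + sobSeminorm d k ((d : ℝ) / ((k : ℝ) - 1)) u
                  + sobSeminorm d (k + 1) ((d : ℝ) / (k : ℝ)) u) *
              ∫ x, ∫ y, μ x * μ y * ‖x - y‖ ^ (-α) := by
  have : Nontrivial (EuclideanSpace ℝ (Fin d)) :=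
    Module.nontrivial_of_finrank_pos (R := ℝ) (by rw [finrank_euclideanSpace_fin]; lia)
  have hfin : (Module.finrank ℝ (EuclideanSpace ℝ (Fin d)) : ℝ) = d := by
    rw [finrank_euclideanSpace_fin]
  have hk0 : 0 < k := by
    rw [hk, Nat.floor_pos]
    linarith
  have hle : (k : ℝ) ≤ (d - α) / 2 := hk ▸ Nat.floor_le (by linarith)
  have hlt : (d - α) / 2 < (k : ℝ) + 1 := hk ▸ Nat.lt_floor_add_one _
  have hne : (k : ℝ) ≠ (d - α) / 2 := fun h ↦ hres k (by linarith)
  have hne' : (k : ℝ) < (d - α) / 2 := lt_of_le_of_ne hle hne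
  have hs : 2 * (k + ((d - α) / 2 - k)) = d - α := by ring
  obtain ⟨C, hC0, hC⟩ := exists_integral_rpow_mul_transportSymbol_le hk0
    (a := (d - α) / 2 - k) ⟨by linarith, by linarith⟩ (by rw [hfin]; linarith)
    (EuclideanSpace.basisFun (Fin d) ℝ)
  obtain ⟨c, hc0, hc⟩ := exists_integral_transport_eq_and_energy_eq
    (EuclideanSpace.basisFun (Fin d) ℝ) hα₁ (by rw [hfin]; linarith)
  refine ⟨C + 1, by positivity, fun μ hμ hμc u hu huc ↦ ?_⟩
  let m : 𝓢(EuclideanSpace ℝ (Fin d), ℂ) :=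
    (hμc.comp_left Complex.ofReal_zero).toSchwartzMap (Complex.ofRealCLM.contDiff.comp hμ)
  let v : 𝓢(EuclideanSpace ℝ (Fin d), EuclideanSpace ℝ (Fin d)) := huc.toSchwartzMap hu
  obtain ⟨hT, hE⟩ := hc hμ hμc m fun x ↦ rfl
  have hbdd : BddAbove (Set.range fun x ↦ ‖fderiv ℝ u x‖) :=
    (hu.continuous_fderiv (by simp)).norm.bddAbove_range_of_hasCompactSupport
      (huc.fderiv ℝ).norm
  have key := hC v m (⨆ x, ‖fderiv ℝ u x‖) fun x ↦ le_ciSup hbdd x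
  have hkd : 0 < (Module.finrank ℝ (EuclideanSpace ℝ (Fin d)) : ℝ≥0) / k := by
    rw [finrank_euclideanSpace_fin]
    have : 0 < d := by lia
    positivity
  rw [toReal_eLpNorm_iteratedFDeriv_eq_sobSeminorm _ hkd] at key
  have hp : (((Module.finrank ℝ (EuclideanSpace ℝ (Fin d)) : ℝ≥0) / k : ℝ≥0) : ℝ) = d / k := by
    push_cast
    rw [hfin]
  rw [hp, hs] at key
  have hT' := hT v
  rw [hfin] at hT' hE
  have hin : ∀ x y, ∑ i, u x i * (x i - y i) = inner ℝ (v x) (x - y) := fun x y ↦ by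
    simp only [PiLp.inner_apply, RCLike.inner_apply, conj_trivial, PiLp.sub_apply]
    exact Finset.sum_congr rfl fun i _ ↦ mul_comm _ _
  simp_rw [hin]
  rw [hT', hE]
  have hE0 : 0 ≤ ∫ w, ‖w‖ ^ (-(d - α)) * ‖𝓕 m w‖ ^ 2 := by positivity
  have hM0 : 0 ≤ ⨆ x, ‖fderiv ℝ u x‖ := Real.iSup_nonneg fun _ ↦ norm_nonneg _
  have hS := sobSeminorm_nonneg d k (d / (k - 1)) u
  have hS' := sobSeminorm_nonneg d (k + 1) (d / k) u
  calc _ ≤ c * (C * ((⨆ x, ‖fderiv ℝ u x‖) + sobSeminorm d (k + 1) (d / k) u) *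
        ∫ w, ‖w‖ ^ (-(d - α)) * ‖𝓕 m w‖ ^ 2) := by gcongr; exact key
    _ ≤ c * ((C + 1) * ((⨆ x, ‖fderiv ℝ u x‖) + sobSeminorm d k (d / (k - 1)) u +
        sobSeminorm d (k + 1) (d / k) u) * ∫ w, ‖w‖ ^ (-(d - α)) * ‖𝓕 m w‖ ^ 2) := by
      gcongr <;> linarith
    _ = _ := by ring
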